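/- arXiv:math/0401235 — 2 statements merged into one kernel-verified Lean document; each statement's English description precedes it below -/
import Mathlib

section
/- Let n ≥ 1, c ≥ 0 and 0 ≤ p ≤ n be integers. Then there exist elements a_0,…,a_{2n−2} and b_0,…,b_{2n−2} of ℚ(q) such that for every integer k, F_q(n−1,n,c,p;k) = Σ_{m=0}^{2n−2} ( a_m + (−1)^k b_m ) q^{m k}. (F_q(n−1,n,c,p;k) is a q-quasi-polynomial in k of degree at most 2n−2 and period at most 2.) -/
open Finset

noncomputable def q : RatFunc ℚ := RatFunc.X

noncomputable def qb (a : ℤ) : RatFunc ℚ := (1 - q ^ a) / (1 - q)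

noncomputable def qfac (a : ℤ) (n : ℕ) : RatFunc ℚ := ∏ i ∈ Finset.range n, qb (a + i)

noncomputable def binq (n k : ℤ) : RatFunc ℚ :=
  if 0 ≤ k ∧ k ≤ n then qfac (n - k + 1) k.toNat / qfac 1 k.toNat else 0

/-- A generalized `(r,n,c)` Gelfand-Tsetlin pattern, encoded as `a : ℕ → ℕ → ℤ` with
rows `i = 1,…,r+1`, entries `a i j` for `i-1 ≤ j ≤ n+1`, and `a i j = 0` outside this
trapezoidal domain (a harmless normalization). -/
def IsPattern (r n c : ℕ) (a : ℕ → ℕ → ℤ) : Prop :=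
  (∀ i, 1 ≤ i → i ≤ r + 1 → a i (i - 1) = 0 ∧ a i (n + 1) = c) ∧
  (∀ i j, 2 ≤ i → i ≤ r + 1 → i ≤ j + 1 → j ≤ n →
    ((a i j ≤ a i (j + 1) → a i j ≤ a (i - 1) j ∧ a (i - 1) j ≤ a i (j + 1)) ∧
     (a i (j + 1) < a i j → a i (j + 1) < a (i - 1) j ∧ a (i - 1) j < a i j))) ∧
  (∀ i j, i = 0 ∨ r + 1 < i ∨ j + 1 < i ∨ n + 1 < j → a i j = 0)

/-- The norm of a pattern: the sum of all entries, omitting the first and last entry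
of each row. -/
def patNorm (r n : ℕ) (a : ℕ → ℕ → ℤ) : ℤ :=
  ∑ i ∈ Finset.Icc 1 (r + 1), ∑ j ∈ Finset.Icc i n, a i j

/-- The number of inversions: pairs `(a i j, a i (j+1))` with `a i j > a i (j+1)`, `i ≠ 1`. -/
noncomputable def invCount (r n : ℕ) (a : ℕ → ℕ → ℤ) : ℕ :=
  {ij : ℕ × ℕ | 2 ≤ ij.1 ∧ ij.1 ≤ r + 1 ∧ ij.1 ≤ ij.2 + 1 ∧ ij.2 ≤ n ∧
    a ij.1 (ij.2 + 1) < a ij.1 ij.2}.ncard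

/-- The sign of a pattern. -/
noncomputable def patSign (r n : ℕ) (a : ℕ → ℕ → ℤ) : RatFunc ℚ := (-1) ^ invCount r n a

/-- The number of odd entries among `a 1 1, …, a 1 n`. -/
noncomputable def oddTop (n : ℕ) (a : ℕ → ℕ → ℤ) : ℕ :=
  {j | 1 ≤ j ∧ j ≤ n ∧ Odd (a 1 j)}.ncard

/-- `Fq n c p k` is `F_q(n-1,n,c,p;k)`: the signed generating function of
`(n-1,n,c)`-patterns with `a n n = k` and exactly `p` odd entries in the bottom row,
divided by `q^k`. -/
noncomputable def Fq (n c p : ℕ) (k : ℤ) : RatFunc ℚ :=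
  (∑ᶠ a ∈ {a : ℕ → ℕ → ℤ | IsPattern (n - 1) n c a ∧ a n n = k ∧ oddTop n a = p},
    patSign (n - 1) n a * q ^ patNorm (n - 1) n a) / q ^ k

/-- The `q`-weighted sum of `f` over the half-open interval from `a` to `b`, with the
orientation convention of interval integrals. -/
noncomputable def qsum (a b : ℤ) (f : ℤ → RatFunc ℚ) : RatFunc ℚ :=
  ∑ x ∈ Ioc a b, q ^ x * f x - ∑ x ∈ Ioc b a, q ^ x * f x

theorem qsum_eq_sum_indicator {a b : ℤ} (f : ℤ → RatFunc ℚ) {s t : ℤ}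
    (hsa : s ≤ a) (hsb : s ≤ b) (hat : a ≤ t) (hbt : b ≤ t) :
    qsum a b f =
      ∑ x ∈ Ioc s t, ((if x ≤ b then 1 else 0) - (if x ≤ a then 1 else 0)) * (q ^ x * f x) := by
  have key : ∀ u v : ℤ, s ≤ u → v ≤ t → ∑ x ∈ Ioc u v, q ^ x * f x =
      ∑ x ∈ Ioc s t, (if u < x ∧ x ≤ v then 1 else 0) * (q ^ x * f x) := by
    intro u v hu hv
    simp only [ite_mul, one_mul, zero_mul]
    rw [← Finset.sum_filter]
    refine Finset.sum_congr ?_ fun _ _ => rfl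
    ext x
    simp only [mem_Ioc, mem_filter]
    omega
  rw [qsum, key a b hsa hbt, key b a hsb hat, ← Finset.sum_sub_distrib]
  refine Finset.sum_congr rfl fun x _ => ?_
  rw [← sub_mul]
  congr 1
  split_ifs <;> first | (exfalso; omega) | simp

theorem qsum_self (a : ℤ) (f : ℤ → RatFunc ℚ) : qsum a a f = 0 := by
  simp [qsum]

theorem qsum_add_adjacent (a b c : ℤ) (f : ℤ → RatFunc ℚ) :
    qsum a b f + qsum b c f = qsum a c f := by
  have h1 : min a (min b c) ≤ a := by omega
  have h2 : min a (min b c) ≤ b := by omega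
  have h3 : min a (min b c) ≤ c := by omega
  have h4 : a ≤ max a (max b c) := by omega
  have h5 : b ≤ max a (max b c) := by omega
  have h6 : c ≤ max a (max b c) := by omega
  rw [qsum_eq_sum_indicator f h1 h2 h4 h5, qsum_eq_sum_indicator f h2 h3 h5 h6,
    qsum_eq_sum_indicator f h1 h3 h4 h6, ← Finset.sum_add_distrib]
  exact Finset.sum_congr rfl fun x _ => by ring

theorem qsum_symm (a b : ℤ) (f : ℤ → RatFunc ℚ) : qsum b a f = -qsum a b f := by
  simp [qsum]

theorem qsum_add (a b : ℤ) (f g : ℤ → RatFunc ℚ) :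
    qsum a b (fun x => f x + g x) = qsum a b f + qsum a b g := by
  simp only [qsum, mul_add, Finset.sum_add_distrib]
  ring

theorem qsum_mul_left (a b : ℤ) (r : RatFunc ℚ) (f : ℤ → RatFunc ℚ) :
    qsum a b (fun x => r * f x) = r * qsum a b f := by
  simp only [qsum, mul_left_comm _ r, ← Finset.mul_sum]
  ring

theorem qsum_mul_right (a b : ℤ) (r : RatFunc ℚ) (f : ℤ → RatFunc ℚ) :
    qsum a b (fun x => f x * r) = qsum a b f * r := by
  simp only [mul_comm _ r, qsum_mul_left]

theorem qsum_neg (a b : ℤ) (f : ℤ → RatFunc ℚ) :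
    qsum a b (fun x => -f x) = -qsum a b f := by
  simpa using qsum_mul_left a b (-1) f

theorem qsum_sub (a b : ℤ) (f g : ℤ → RatFunc ℚ) :
    qsum a b (fun x => f x - g x) = qsum a b f - qsum a b g := by
  simp only [sub_eq_add_neg, qsum_add, qsum_neg]

theorem qsum_comm (a b c d : ℤ) (f : ℤ → ℤ → RatFunc ℚ) :
    qsum a b (fun x => qsum c d (fun y => f x y)) =
      qsum c d (fun y => qsum a b (fun x => f x y)) := by
  have key : ∀ s t : Finset ℤ, ∑ x ∈ s, q ^ x * ∑ y ∈ t, q ^ y * f x y =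
      ∑ y ∈ t, q ^ y * ∑ x ∈ s, q ^ x * f x y := by
    intro s t
    simp only [Finset.mul_sum]
    rw [Finset.sum_comm]
    exact Finset.sum_congr rfl fun _ _ => Finset.sum_congr rfl fun _ _ => by ring
  simp only [qsum, mul_sub, Finset.sum_sub_distrib, key]
  ring

theorem qsum_mem {ι : Type*} (M : Submodule (RatFunc ℚ) (ι → RatFunc ℚ)) (a b : ℤ)
    (f : ℤ → ι → RatFunc ℚ) (hf : ∀ x, f x ∈ M) :
    (fun i => qsum a b (fun x => f x i)) ∈ M := by
  have : (fun i => qsum a b (fun x => f x i)) =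
      ∑ x ∈ Ioc a b, q ^ x • f x - ∑ x ∈ Ioc b a, q ^ x • f x := by
    ext i
    simp [qsum]
  rw [this]
  exact M.sub_mem (M.sum_mem fun x _ => M.smul_mem _ (hf x))
    (M.sum_mem fun x _ => M.smul_mem _ (hf x))

/-- The symmetrization of a double sum over a square. -/
theorem two_mul_qsum_square (a b : ℤ) (f : ℤ → ℤ → RatFunc ℚ) :
    2 * qsum a b (fun x => qsum a b (fun y => f x y)) =
      qsum a b (fun x => qsum a b (fun y => f x y + f y x)) := by
  simp only [qsum_add]
  rw [qsum_comm a b a b (fun x y => f y x)]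
  ring

/-- Iterated `q`-sums of a function of a list of integers: the `i`-th entry of the list
runs through the interval between the nodes `i` and `i + 1`. -/
noncomputable def nodeSum : (List ℤ → RatFunc ℚ) → List ℤ → RatFunc ℚ
  | F, [] => F []
  | F, [_] => F []
  | F, a :: b :: l => qsum a b fun x => nodeSum (fun m => F (x :: m)) (b :: l)

theorem nodeSum_cons_cons (F : List ℤ → RatFunc ℚ) (a b : ℤ) (l : List ℤ) :
    nodeSum F (a :: b :: l) = qsum a b fun x => nodeSum (fun m => F (x :: m)) (b :: l) := by
  rw [nodeSum]

theorem nodeSum_add (F G : List ℤ → RatFunc ℚ) (l : List ℤ) :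
    nodeSum (fun m => F m + G m) l = nodeSum F l + nodeSum G l := by
  induction l generalizing F G with
  | nil => simp [nodeSum]
  | cons a l ih =>
    cases l with
    | nil => simp [nodeSum]
    | cons b l => simp only [nodeSum_cons_cons, ih, qsum_add]

theorem nodeSum_mem {ι : Type*} (M : Submodule (RatFunc ℚ) (ι → RatFunc ℚ))
    (F : ι → List ℤ → RatFunc ℚ) (l : List ℤ) (hF : ∀ m, (fun i => F i m) ∈ M) :
    (fun i => nodeSum (F i) l) ∈ M := by
  induction l generalizing F with
  | nil => simpa [nodeSum] using hF []
  | cons a l ih =>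
    cases l with
    | nil => simpa [nodeSum] using hF []
    | cons b l =>
      simp only [nodeSum_cons_cons]
      exact qsum_mem M a b _ fun x => ih (fun i m => F i (x :: m)) fun m => hF (x :: m)

/-- Symmetrizing `F` in two adjacent entries yields `H`, independently of the position
of these two entries in the list. -/
def AdjSymm (F : List ℤ → RatFunc ℚ) (H : ℤ → ℤ → List ℤ → RatFunc ℚ) : Prop :=
  ∀ l x y m, F (l ++ x :: y :: m) + F (l ++ y :: x :: m) = H x y (l ++ m)

theorem AdjSymm.cons {F : List ℤ → RatFunc ℚ} {H : ℤ → ℤ → List ℤ → RatFunc ℚ}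
    (h : AdjSymm F H) (x : ℤ) : AdjSymm (fun m => F (x :: m)) (fun y z m => H y z (x :: m)) :=
  fun l y z m => h (x :: l) y z m

/-- The effect of `nodeSum` on the symmetrizations. -/
noncomputable def symmStep (H : ℤ → ℤ → List ℤ → RatFunc ℚ) (y z : ℤ) (l : List ℤ) : RatFunc ℚ :=
  -(1 / 2) * qsum y z fun u => qsum y z fun v => nodeSum (H u v) l

theorem qsum_triple_swap (a y z b : ℤ) (f h : ℤ → ℤ → ℤ → RatFunc ℚ)
    (h1 : ∀ u v w, f u v w + f v u w = h u v w) (h2 : ∀ u v w, f u v w + f u w v = h v w u) :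
    (qsum a y fun u => qsum y z fun v => qsum z b fun w => f u v w) +
      (qsum a z fun u => qsum z y fun v => qsum y b fun w => f u v w) =
    -(1 / 2) * qsum y z fun u => qsum y z fun v => qsum a b fun w => h u v w := by
  have e1 : ∀ u v, qsum z b (fun w => f u v w) =
      qsum y b (fun w => f u v w) - qsum y z (fun w => f u v w) := fun u v => by
    rw [← qsum_add_adjacent y z b]
    ring
  have e2 : ∀ g : ℤ → RatFunc ℚ, qsum a z g = qsum a y g + qsum y z g := fun g =>
    (qsum_add_adjacent a y z g).symm
  have e3 : ∀ g : ℤ → RatFunc ℚ, qsum z y g = -qsum y z g := fun g => qsum_symm y z g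
  have e4 : ∀ u v, qsum a b (fun w => h u v w) =
      qsum a y (fun w => h u v w) + qsum y b (fun w => h u v w) := fun u v =>
    (qsum_add_adjacent a y b _).symm
  have s1 : 2 * (qsum a y fun u => qsum y z fun v => qsum y z fun w => f u v w) =
      qsum y z fun u => qsum y z fun v => qsum a y fun w => h u v w := by
    rw [← qsum_mul_left]
    simp only [two_mul_qsum_square, h2]
    rw [qsum_comm]
    simp only [qsum_comm a y y z]
  have s2 : 2 * (qsum y z fun u => qsum y z fun v => qsum y b fun w => f u v w) =
      qsum y z fun u => qsum y z fun v => qsum y b fun w => h u v w := by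
    rw [two_mul_qsum_square]
    simp only [← qsum_add, h1]
  simp only [e1, e2, e3, e4, qsum_add, qsum_sub, qsum_neg]
  linear_combination (-1 / 2) * s1 - (1 / 2) * s2

theorem AdjSymm.nodeSum_swap {F : List ℤ → RatFunc ℚ} {H : ℤ → ℤ → List ℤ → RatFunc ℚ}
    (h : AdjSymm F H) (a : ℤ) (l : List ℤ) (y z b : ℤ) (m : List ℤ) :
    nodeSum F (a :: l ++ y :: z :: b :: m) + nodeSum F (a :: l ++ z :: y :: b :: m) =
      symmStep H y z (a :: l ++ b :: m) := by
  induction l generalizing a F H with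
  | nil =>
    simp only [List.cons_append, List.nil_append, nodeSum_cons_cons, symmStep]
    refine qsum_triple_swap a y z b
      (fun u v w => nodeSum (fun k => F (u :: v :: w :: k)) (b :: m))
      (fun u v w => nodeSum (fun k => H u v (w :: k)) (b :: m)) ?_ ?_
    · intro u v w
      rw [← nodeSum_add]
      congr 1
      ext k
      exact h [] u v (w :: k)
    · intro u v w
      rw [← nodeSum_add]
      congr 1
      ext k
      exact h [u] v w k
  | cons c l ih =>
    have key := fun x => ih (h.cons x) c
    simp only [List.cons_append, nodeSum_cons_cons, symmStep] at key ⊢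
    rw [← qsum_add]
    simp only [key, qsum_mul_left]
    rw [qsum_comm]
    simp only [qsum_comm a c y z]

/-- The summation operator on functions of lists, with outermost nodes `a` and `b`. -/
noncomputable def rowSum (a b : ℤ) (F : List ℤ → RatFunc ℚ) (l : List ℤ) : RatFunc ℚ :=
  nodeSum F (a :: l ++ [b])

theorem AdjSymm.rowSum {F : List ℤ → RatFunc ℚ} {H : ℤ → ℤ → List ℤ → RatFunc ℚ}
    (h : AdjSymm F H) (a b : ℤ) :
    AdjSymm (rowSum a b F) (fun y z l => symmStep H y z (a :: l ++ [b])) := by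
  intro l x y m
  cases m with
  | nil => simpa [_root_.rowSum] using h.nodeSum_swap a l x y b []
  | cons c m => simpa [_root_.rowSum] using h.nodeSum_swap a l x y c (m ++ [b])

theorem q_ne_zero : q ≠ 0 := RatFunc.X_ne_zero

theorem q_pow_succ_ne (m : ℕ) (r : ℚ) : q ^ (m + 1) ≠ algebraMap ℚ (RatFunc ℚ) r := by
  intro h
  have h2 : algebraMap (Polynomial ℚ) (RatFunc ℚ) (Polynomial.X ^ (m + 1)) =
      algebraMap (Polynomial ℚ) (RatFunc ℚ) (Polynomial.C r) := by
    rw [map_pow, RatFunc.algebraMap_X, RatFunc.algebraMap_C]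
    simpa [q, RatFunc.algebraMap_eq_C] using h
  have h3 := congrArg Polynomial.natDegree (RatFunc.algebraMap_injective ℚ h2)
  simp at h3

/-- The number `ε q ^ m` for a sign `ε`. -/
noncomputable def signedPow (ε : ℤˣ) (m : ℕ) : RatFunc ℚ := ((ε : ℤ) : RatFunc ℚ) * q ^ m

theorem signedPow_ne_zero (ε : ℤˣ) (m : ℕ) : signedPow ε m ≠ 0 :=
  mul_ne_zero (by rcases Int.units_eq_one_or ε with rfl | rfl <;> simp)
    (pow_ne_zero _ q_ne_zero)

theorem signedPow_succ_ne_one (ε : ℤˣ) (m : ℕ) : signedPow ε (m + 1) ≠ 1 := by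
  intro h
  rcases Int.units_eq_one_or ε with rfl | rfl
  · exact q_pow_succ_ne m 1 (by simpa [signedPow] using h)
  · refine q_pow_succ_ne m (-1) ?_
    rw [map_neg, map_one, ← h]
    simp [signedPow]

theorem signedPow_succ (ε : ℤˣ) (m : ℕ) : signedPow ε (m + 1) = q * signedPow ε m := by
  simp only [signedPow, pow_succ]
  ring

theorem signedPow_mul (ε δ : ℤˣ) (m k : ℕ) :
    signedPow ε m * signedPow δ k = signedPow (ε * δ) (m + k) := by
  simp only [signedPow, pow_add, Units.val_mul, Int.cast_mul]
  ring

theorem qsum_signedPow (ε : ℤˣ) (m : ℕ) : ∃ κ : RatFunc ℚ, ∀ a b : ℤ,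
    qsum a b (fun x => signedPow ε m ^ x) =
      κ * (signedPow ε (m + 1) ^ b - signedPow ε (m + 1) ^ a) := by
  set ρ := signedPow ε (m + 1) with hρ
  have h0 : ρ ≠ 0 := signedPow_ne_zero ε (m + 1)
  have h1 : ρ - 1 ≠ 0 := sub_ne_zero.mpr (signedPow_succ_ne_one ε m)
  refine ⟨ρ / (ρ - 1), ?_⟩
  have step : ∀ (a : ℤ) (k : ℕ), qsum a (a + k) (fun x => signedPow ε m ^ x) =
      ρ / (ρ - 1) * (ρ ^ (a + k) - ρ ^ a) := by
    intro a k
    induction k with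
    | zero => simp [qsum_self]
    | succ k ih =>
      have hs : qsum (a + k) (a + (k + 1 : ℕ)) (fun x => signedPow ε m ^ x) =
          ρ ^ (a + (k + 1 : ℕ)) := by
        have e1 : Ioc (a + k : ℤ) (a + (k + 1 : ℕ)) = {a + ((k + 1 : ℕ) : ℤ)} := by
          ext x
          simp only [mem_Ioc, mem_singleton]
          omega
        have e2 : Ioc (a + ((k + 1 : ℕ) : ℤ)) (a + k) = ∅ :=
          Finset.Ioc_eq_empty (by push_cast; omega)
        rw [qsum, e1, e2, Finset.sum_singleton, Finset.sum_empty, sub_zero, ← mul_zpow,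
          ← signedPow_succ]
      rw [← qsum_add_adjacent a (a + k), ih, hs]
      have : ρ ^ (a + ((k + 1 : ℕ) : ℤ)) = ρ ^ (a + (k : ℤ)) * ρ := by
        rw [← zpow_add_one₀ h0]
        congr 1
        push_cast
        ring
      rw [this]
      field_simp
      ring
  intro a b
  rcases le_total a b with h | h
  · obtain ⟨k, rfl⟩ := Int.le.dest h
    exact step a k
  · obtain ⟨k, rfl⟩ := Int.le.dest h
    rw [qsum_symm, step b k]
    ring

/-- The `q`-quasi-polynomials of degree at most `d` and period at most `2`. -/
noncomputable def quasiPoly (d : ℕ) : Submodule (RatFunc ℚ) (ℤ → RatFunc ℚ) :=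
  Submodule.span _ {f | ∃ (ε : ℤˣ) (m : ℕ), m ≤ d ∧ f = fun x => signedPow ε m ^ x}

/-- The `q`-quasi-polynomials in two variables of total degree at most `d` and period
at most `2`. -/
noncomputable def quasiPoly₂ (d : ℕ) : Submodule (RatFunc ℚ) (ℤ × ℤ → RatFunc ℚ) :=
  Submodule.span _ {f | ∃ (ε δ : ℤˣ) (m k : ℕ), m + k ≤ d ∧
    f = fun x => signedPow ε m ^ x.1 * signedPow δ k ^ x.2}

theorem signedPow_mem_quasiPoly (ε : ℤˣ) {m d : ℕ} (h : m ≤ d) :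
    (fun x : ℤ => signedPow ε m ^ x) ∈ quasiPoly d :=
  Submodule.subset_span ⟨ε, m, h, rfl⟩

theorem signedPow_mem_quasiPoly₂ (ε δ : ℤˣ) {m k d : ℕ} (h : m + k ≤ d) :
    (fun x : ℤ × ℤ => signedPow ε m ^ x.1 * signedPow δ k ^ x.2) ∈ quasiPoly₂ d :=
  Submodule.subset_span ⟨ε, δ, m, k, h, rfl⟩

theorem const_mem_quasiPoly (r : RatFunc ℚ) (d : ℕ) : (fun _ : ℤ => r) ∈ quasiPoly d := by
  convert (quasiPoly d).smul_mem r (signedPow_mem_quasiPoly 1 (Nat.zero_le d)) using 1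
  ext x
  simp [signedPow]

theorem quasiPoly_mono {d e : ℕ} (h : d ≤ e) : quasiPoly d ≤ quasiPoly e :=
  Submodule.span_mono fun _ ⟨ε, m, hm, hf⟩ => ⟨ε, m, hm.trans h, hf⟩

/-- Linear maps given by a formula send a span into a submodule once the generators are
sent there. -/
theorem mem_of_mem_span {ι κ : Type*} {s : Set (ι → RatFunc ℚ)}
    {M : Submodule (RatFunc ℚ) (κ → RatFunc ℚ)} (T : (ι → RatFunc ℚ) → κ → RatFunc ℚ)
    (hadd : ∀ f g, T (f + g) = T f + T g) (hsmul : ∀ (r : RatFunc ℚ) f, T (r • f) = r • T f)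
    (hs : ∀ f ∈ s, T f ∈ M) {f : ι → RatFunc ℚ}
    (hf : f ∈ Submodule.span (RatFunc ℚ) s) : T f ∈ M := by
  induction hf using Submodule.span_induction with
  | mem x hx => exact hs x hx
  | zero =>
    have : T 0 = 0 := by simpa using hsmul 0 0
    rw [this]
    exact M.zero_mem
  | add x y _ _ hx hy => rw [hadd]; exact M.add_mem hx hy
  | smul r x _ hx => rw [hsmul]; exact M.smul_mem r hx

theorem qsum_left_mem_quasiPoly {d : ℕ} {f : ℤ → RatFunc ℚ} (hf : f ∈ quasiPoly d) (b : ℤ) :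
    (fun a => qsum a b f) ∈ quasiPoly (d + 1) := by
  refine mem_of_mem_span (fun f a => qsum a b f) ?_ ?_ ?_ hf
  · exact fun f g => funext fun a => qsum_add a b f g
  · exact fun r f => funext fun a => qsum_mul_left a b r f
  · rintro _ ⟨ε, m, hm, rfl⟩
    obtain ⟨κ, hκ⟩ := qsum_signedPow ε m
    simp only [hκ]
    refine (quasiPoly (d + 1)).smul_mem κ ((quasiPoly (d + 1)).sub_mem ?_ ?_)
    · exact const_mem_quasiPoly _ _
    · exact signedPow_mem_quasiPoly ε (by omega)

theorem quasiPoly₂_right {d : ℕ} {f : ℤ → ℤ → RatFunc ℚ}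
    (hf : (fun x : ℤ × ℤ => f x.1 x.2) ∈ quasiPoly₂ d) (x : ℤ) : f x ∈ quasiPoly d := by
  refine mem_of_mem_span (f := fun x : ℤ × ℤ => f x.1 x.2) (M := quasiPoly d)
    (fun f y => f (x, y)) (fun _ _ => rfl) (fun _ _ => rfl) ?_ hf
  rintro _ ⟨ε, δ, m, k, h, rfl⟩
  exact (quasiPoly d).smul_mem (signedPow ε m ^ x)
    (signedPow_mem_quasiPoly δ (show k ≤ d by omega))

theorem qsum_qsum_mem_quasiPoly {d : ℕ} {f : ℤ → ℤ → RatFunc ℚ}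
    (hf : (fun x : ℤ × ℤ => f x.1 x.2) ∈ quasiPoly₂ d) (a b : ℤ) :
    (fun z => qsum a z fun x => qsum z b fun y => f x y) ∈ quasiPoly (d + 2) := by
  refine mem_of_mem_span (f := fun x : ℤ × ℤ => f x.1 x.2) (M := quasiPoly (d + 2))
    (fun f z => qsum a z fun x => qsum z b fun y => f (x, y)) ?_ ?_ ?_ hf
  · exact fun f g => funext fun z => by simp only [Pi.add_apply, qsum_add]
  · exact fun r f => funext fun z => by simp only [Pi.smul_apply, smul_eq_mul, qsum_mul_left]
  · rintro _ ⟨ε, δ, m, k, h, rfl⟩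
    obtain ⟨κ, hκ⟩ := qsum_signedPow ε m
    obtain ⟨μ, hμ⟩ := qsum_signedPow δ k
    simp only [qsum_mul_left, qsum_mul_right, hκ, hμ]
    set A := signedPow ε (m + 1) ^ a
    set B := signedPow δ (k + 1) ^ b
    have e : (fun z : ℤ => κ * (signedPow ε (m + 1) ^ z - A) *
        (μ * (B - signedPow δ (k + 1) ^ z))) =
        (κ * μ) • (B • (fun z : ℤ => signedPow ε (m + 1) ^ z) -
          (fun z : ℤ => signedPow (ε * δ) (m + 1 + (k + 1)) ^ z) - (fun _ => A * B) +
          A • fun z : ℤ => signedPow δ (k + 1) ^ z) := by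
      ext z
      simp only [← signedPow_mul, mul_zpow, Pi.smul_apply, Pi.add_apply, Pi.sub_apply,
        smul_eq_mul]
      ring
    rw [e]
    have h1 := signedPow_mem_quasiPoly ε (show m + 1 ≤ d + 2 by omega)
    have h2 := signedPow_mem_quasiPoly δ (show k + 1 ≤ d + 2 by omega)
    have h3 := signedPow_mem_quasiPoly (ε * δ) (show m + 1 + (k + 1) ≤ d + 2 by omega)
    have h4 := const_mem_quasiPoly (A * B) (d + 2)
    exact Submodule.smul_mem _ _ (Submodule.add_mem _ (Submodule.sub_mem _ (Submodule.sub_mem _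
      (Submodule.smul_mem _ _ h1) h3) h4) (Submodule.smul_mem _ _ h2))

theorem qsum_square_mem_quasiPoly₂ {d : ℕ} {f : ℤ → ℤ → RatFunc ℚ}
    (hf : (fun x : ℤ × ℤ => f x.1 x.2) ∈ quasiPoly₂ d) :
    (fun z : ℤ × ℤ => qsum z.1 z.2 fun x => qsum z.1 z.2 fun y => f x y) ∈
      quasiPoly₂ (d + 2) := by
  refine mem_of_mem_span (f := fun x : ℤ × ℤ => f x.1 x.2) (M := quasiPoly₂ (d + 2))
    (fun f (z : ℤ × ℤ) => qsum z.1 z.2 fun x => qsum z.1 z.2 fun y => f (x, y)) ?_ ?_ ?_ hf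
  · exact fun f g => funext fun z => by simp only [Pi.add_apply, qsum_add]
  · exact fun r f => funext fun z => by simp only [Pi.smul_apply, smul_eq_mul, qsum_mul_left]
  · rintro _ ⟨ε, δ, m, k, h, rfl⟩
    obtain ⟨κ, hκ⟩ := qsum_signedPow ε m
    obtain ⟨μ, hμ⟩ := qsum_signedPow δ k
    simp only [qsum_mul_left, qsum_mul_right, hκ, hμ]
    have e : (fun z : ℤ × ℤ => κ * (signedPow ε (m + 1) ^ z.2 - signedPow ε (m + 1) ^ z.1) *
        (μ * (signedPow δ (k + 1) ^ z.2 - signedPow δ (k + 1) ^ z.1))) =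
        (κ * μ) • ((fun z : ℤ × ℤ => signedPow 1 0 ^ z.1 *
            signedPow (ε * δ) (m + 1 + (k + 1)) ^ z.2) -
          (fun z : ℤ × ℤ => signedPow δ (k + 1) ^ z.1 * signedPow ε (m + 1) ^ z.2) -
          (fun z : ℤ × ℤ => signedPow ε (m + 1) ^ z.1 * signedPow δ (k + 1) ^ z.2) +
          fun z : ℤ × ℤ => signedPow (ε * δ) (m + 1 + (k + 1)) ^ z.1 * signedPow 1 0 ^ z.2) := by
      ext z
      have h1 : signedPow 1 0 = 1 := by simp [signedPow]
      simp only [← signedPow_mul, mul_zpow, Pi.smul_apply, Pi.add_apply, Pi.sub_apply,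
        smul_eq_mul, h1, one_zpow]
      ring
    rw [e]
    exact Submodule.smul_mem _ _ (Submodule.add_mem _ (Submodule.sub_mem _ (Submodule.sub_mem _
      (signedPow_mem_quasiPoly₂ _ _ (by omega)) (signedPow_mem_quasiPoly₂ _ _ (by omega)))
      (signedPow_mem_quasiPoly₂ _ _ (by omega))) (signedPow_mem_quasiPoly₂ _ _ (by omega)))

/-- The degree of a double sum whose summation ranges share an endpoint, in terms of the
symmetrization of the summand. -/
theorem qsum_qsum_mem_quasiPoly_of_symm {d : ℕ} {f h : ℤ → ℤ → RatFunc ℚ}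
    (hf : ∀ x, f x ∈ quasiPoly d) (hh : (fun x : ℤ × ℤ => h x.1 x.2) ∈ quasiPoly₂ d)
    (hfh : ∀ x y, f x y + f y x = h x y) (a b : ℤ) :
    (fun z => qsum a z fun x => qsum z b fun y => f x y) ∈ quasiPoly (d + 2) := by
  set g : ℤ → ℤ → RatFunc ℚ := fun x y => f x y - 1 / 2 * h x y with hg
  have hg0 : ∀ z, (qsum z b fun x => qsum z b fun y => g x y) = 0 := by
    intro z
    have h2 := two_mul_qsum_square z b g
    have : ∀ x y, g x y + g y x = (0 : RatFunc ℚ) * 0 := fun x y => by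
      have := hfh x y
      have h3 := hfh y x
      simp only [hg]
      linear_combination (1 / 2) * this + (1 / 2) * h3
    simp only [this, qsum_mul_left] at h2
    simpa using h2
  have e : (fun z => qsum a z fun x => qsum z b fun y => f x y) =
      (fun z => qsum a b fun x => qsum z b fun y => g x y) +
        (1 / 2 : RatFunc ℚ) • fun z => qsum a z fun x => qsum z b fun y => h x y := by
    ext z
    have h1 : ∀ x y, f x y = g x y + 1 / 2 * h x y := fun x y => by simp [hg]
    simp only [h1, qsum_add, qsum_mul_left, Pi.add_apply, Pi.smul_apply, smul_eq_mul]
    rw [← qsum_add_adjacent a z b (fun x => qsum z b fun y => g x y), hg0, add_zero]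
  rw [e]
  refine Submodule.add_mem _ ?_ (Submodule.smul_mem _ _ (qsum_qsum_mem_quasiPoly hh a b))
  refine qsum_mem _ a b (fun x z => qsum z b fun y => g x y) fun x => ?_
  refine quasiPoly_mono (Nat.le_succ _) (qsum_left_mem_quasiPoly ?_ b)
  exact Submodule.sub_mem _ (hf x) (Submodule.smul_mem _ (1 / 2) (quasiPoly₂_right hh x))

/-- `F` is a `q`-quasi-polynomial of degree at most `d` in each entry of the list. -/
def EntryDegLE (F : List ℤ → RatFunc ℚ) (d : ℕ) : Prop :=
  ∀ l m, (fun x => F (l ++ x :: m)) ∈ quasiPoly d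

theorem EntryDegLE.nodeSum {F : List ℤ → RatFunc ℚ} {H : ℤ → ℤ → List ℤ → RatFunc ℚ} {d : ℕ}
    (hF : EntryDegLE F d) (h : AdjSymm F H)
    (hH : ∀ l, (fun x : ℤ × ℤ => H x.1 x.2 l) ∈ quasiPoly₂ d) (a : ℤ) (l : List ℤ) (b : ℤ)
    (m : List ℤ) : (fun z => nodeSum F (a :: l ++ z :: b :: m)) ∈ quasiPoly (d + 2) := by
  induction l generalizing a F H with
  | nil =>
    simp only [List.cons_append, List.nil_append, nodeSum_cons_cons]
    refine qsum_qsum_mem_quasiPoly_of_symm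
      (f := fun u v => _root_.nodeSum (fun k => F (u :: v :: k)) (b :: m))
      (h := fun u v => _root_.nodeSum (H u v) (b :: m)) ?_ ?_ ?_ a b
    · exact fun x => nodeSum_mem _ _ _ fun k => hF [x] k
    · exact nodeSum_mem _ (fun x : ℤ × ℤ => H x.1 x.2) _ hH
    · intro u v
      rw [← nodeSum_add]
      congr 1
      ext k
      exact h [] u v k
  | cons c l ih =>
    simp only [List.cons_append, nodeSum_cons_cons]
    exact qsum_mem _ a c _ fun x =>
      ih (fun l m => hF (x :: l) m) (h.cons x) (fun l => hH (x :: l)) c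

theorem EntryDegLE.rowSum {F : List ℤ → RatFunc ℚ} {H : ℤ → ℤ → List ℤ → RatFunc ℚ} {d : ℕ}
    (hF : EntryDegLE F d) (h : AdjSymm F H)
    (hH : ∀ l, (fun x : ℤ × ℤ => H x.1 x.2 l) ∈ quasiPoly₂ d) (a b : ℤ) :
    EntryDegLE (rowSum a b F) (d + 2) := by
  intro l m
  cases m with
  | nil => simpa [_root_.rowSum] using hF.nodeSum h hH a l b []
  | cons c m => simpa [_root_.rowSum] using hF.nodeSum h hH a l c (m ++ [b])

theorem symmStep_mem_quasiPoly₂ {H : ℤ → ℤ → List ℤ → RatFunc ℚ} {d : ℕ}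
    (hH : ∀ l, (fun x : ℤ × ℤ => H x.1 x.2 l) ∈ quasiPoly₂ d) (l : List ℤ) :
    (fun x : ℤ × ℤ => symmStep H x.1 x.2 l) ∈ quasiPoly₂ (d + 2) :=
  Submodule.smul_mem _ _ (qsum_square_mem_quasiPoly₂
    (nodeSum_mem _ (fun x : ℤ × ℤ => H x.1 x.2) l hH))

/-- Iterated row sums starting from `F`, with left node `-1` and right nodes
`e - 1, e - 2, …`. -/
noncomputable def iterRowSum (F : List ℤ → RatFunc ℚ) (e : ℤ) : ℕ → List ℤ → RatFunc ℚ
  | 0 => F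
  | r + 1 => rowSum (-1) (e - (r + 1)) (iterRowSum F e r)

theorem entryDegLE_iterRowSum {F : List ℤ → RatFunc ℚ} {H : ℤ → ℤ → List ℤ → RatFunc ℚ}
    (hF : EntryDegLE F 0) (h : AdjSymm F H)
    (hH : ∀ l, (fun x : ℤ × ℤ => H x.1 x.2 l) ∈ quasiPoly₂ 0) (e : ℤ) (r : ℕ) :
    EntryDegLE (iterRowSum F e r) (2 * r) := by
  suffices EntryDegLE (iterRowSum F e r) (2 * r) ∧
      ∃ H, AdjSymm (iterRowSum F e r) H ∧
        ∀ l, (fun x : ℤ × ℤ => H x.1 x.2 l) ∈ quasiPoly₂ (2 * r) from this.1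
  induction r with
  | zero => exact ⟨hF, H, h, hH⟩
  | succ r ih =>
    obtain ⟨h1, H', h2, h3⟩ := ih
    exact ⟨h1.rowSum h2 h3 _ _, _, h2.rowSum _ _, fun l => symmStep_mem_quasiPoly₂ h3 _⟩

/-- The number of entries of a list that are odd after subtracting their position,
where positions start at `s`. -/
def oddCount : ℤ → List ℤ → ℕ
  | _, [] => 0
  | s, x :: l => (if Odd (x - s) then 1 else 0) + oddCount (s + 1) l

theorem oddCount_append_cons_cons (s : ℤ) (l : List ℤ) (x y : ℤ) (m : List ℤ) :
    oddCount s (l ++ x :: y :: m) =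
      if Even l.length then oddCount s (x :: y :: (l ++ m)) else oddCount s (y :: x :: (l ++ m)) := by
  induction l generalizing s with
  | nil => simp
  | cons z l ih =>
    have h1 : ∀ x, Odd (x - (s + 1 + 1)) ↔ Odd (x - s) := fun x => by
      simp only [Int.odd_iff]
      omega
    rw [List.cons_append, oddCount, ih]
    simp only [List.length_cons, Nat.even_add_one, List.cons_append, oddCount, h1]
    split_ifs <;> first | contradiction | omega

theorem oddCount_congr (s : ℤ) (l : List ℤ) {x y : ℤ} (h : Even x ↔ Even y) (m : List ℤ) :
    oddCount s (l ++ x :: m) = oddCount s (l ++ y :: m) := by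
  induction l generalizing s with
  | nil =>
    have h1 : Odd (x - s) ↔ Odd (y - s) := by
      simp only [Int.even_iff, Int.odd_iff] at *
      omega
    simp only [List.nil_append, oddCount, h1]
  | cons z l ih => simp only [List.cons_append, oddCount, ih]

theorem signedPow_neg_one_zero_zpow (x : ℤ) :
    signedPow (-1) 0 ^ x = if Even x then 1 else -1 := by
  have : signedPow (-1) 0 = -1 := by simp [signedPow]
  rw [this]
  split_ifs with h
  · exact h.neg_one_zpow
  · exact (Int.not_even_iff_odd.mp h).neg_one_zpow

theorem signedPow_one_zero_zpow (x : ℤ) : signedPow 1 0 ^ x = 1 := by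
  simp [signedPow]

theorem mem_quasiPoly_of_parity {f : ℤ → RatFunc ℚ}
    (hf : ∀ x y, (Even x ↔ Even y) → f x = f y) : f ∈ quasiPoly 0 := by
  have e : f = ((f 0 + f 1) / 2) • (fun x : ℤ => signedPow 1 0 ^ x) +
      ((f 0 - f 1) / 2) • fun x : ℤ => signedPow (-1) 0 ^ x := by
    ext x
    simp only [Pi.add_apply, Pi.smul_apply, smul_eq_mul, signedPow_neg_one_zero_zpow,
      signedPow_one_zero_zpow]
    split_ifs with h
    · rw [hf x 0 (by simpa using h)]
      ring
    · rw [hf x 1 (by simpa using h)]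
      ring
  rw [e]
  exact Submodule.add_mem _ (Submodule.smul_mem _ _ (signedPow_mem_quasiPoly _ le_rfl))
    (Submodule.smul_mem _ _ (signedPow_mem_quasiPoly _ le_rfl))

theorem mem_quasiPoly₂_of_parity {f : ℤ → ℤ → RatFunc ℚ}
    (hf₁ : ∀ x y z, (Even x ↔ Even y) → f x z = f y z)
    (hf₂ : ∀ x y z, (Even x ↔ Even y) → f z x = f z y) :
    (fun x : ℤ × ℤ => f x.1 x.2) ∈ quasiPoly₂ 0 := by
  have e : (fun x : ℤ × ℤ => f x.1 x.2) =
      ((f 0 0 + f 0 1 + f 1 0 + f 1 1) / 4) •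
        (fun x : ℤ × ℤ => signedPow 1 0 ^ x.1 * signedPow 1 0 ^ x.2) +
      ((f 0 0 - f 0 1 + f 1 0 - f 1 1) / 4) •
        (fun x : ℤ × ℤ => signedPow 1 0 ^ x.1 * signedPow (-1) 0 ^ x.2) +
      ((f 0 0 + f 0 1 - f 1 0 - f 1 1) / 4) •
        (fun x : ℤ × ℤ => signedPow (-1) 0 ^ x.1 * signedPow 1 0 ^ x.2) +
      ((f 0 0 - f 0 1 - f 1 0 + f 1 1) / 4) •
        (fun x : ℤ × ℤ => signedPow (-1) 0 ^ x.1 * signedPow (-1) 0 ^ x.2) := by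
    ext ⟨x, y⟩
    simp only [Pi.add_apply, Pi.smul_apply, smul_eq_mul, signedPow_neg_one_zero_zpow,
      signedPow_one_zero_zpow]
    split_ifs with h h' h'
    · rw [hf₁ x 0 y (by simpa using h'), hf₂ y 0 0 (by simpa using h)]
      ring
    · rw [hf₁ x 1 y (by simpa using h'), hf₂ y 0 1 (by simpa using h)]
      ring
    · rw [hf₁ x 0 y (by simpa using h'), hf₂ y 1 0 (by simpa using h)]
      ring
    · rw [hf₁ x 1 y (by simpa using h'), hf₂ y 1 1 (by simpa using h)]
      ring
  rw [e]
  have hm : ∀ ε δ : ℤˣ, (fun x : ℤ × ℤ => signedPow ε 0 ^ x.1 * signedPow δ 0 ^ x.2) ∈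
      quasiPoly₂ 0 := fun ε δ => signedPow_mem_quasiPoly₂ ε δ le_rfl
  exact Submodule.add_mem _ (Submodule.add_mem _ (Submodule.add_mem _
    (Submodule.smul_mem _ _ (hm _ _)) (Submodule.smul_mem _ _ (hm _ _)))
    (Submodule.smul_mem _ _ (hm _ _))) (Submodule.smul_mem _ _ (hm _ _))

/-- The indicator function of having exactly `p` odd entries. -/
noncomputable def oddIndicator (p : ℕ) (l : List ℤ) : RatFunc ℚ :=
  if oddCount 0 l = p then 1 else 0

theorem entryDegLE_iterRowSum_oddIndicator (p : ℕ) (e : ℤ) (r : ℕ) :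
    EntryDegLE (iterRowSum (oddIndicator p) e r) (2 * r) := by
  refine entryDegLE_iterRowSum
    (H := fun x y l => oddIndicator p (x :: y :: l) + oddIndicator p (y :: x :: l))
    (fun l m => mem_quasiPoly_of_parity fun x y h => ?_) (fun l x y m => ?_)
    (fun l => mem_quasiPoly₂_of_parity
      (f := fun x y => oddIndicator p (x :: y :: l) + oddIndicator p (y :: x :: l)) (fun x y z h => ?_)
      fun x y z h => ?_) e r
  · simp only [oddIndicator, oddCount_congr 0 l h m]
  · simp only [oddIndicator, oddCount_append_cons_cons 0 l]
    split_ifs <;> simp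
  · have h1 := oddCount_congr 0 [] h (z :: l)
    have h2 := oddCount_congr 0 [z] h l
    simp only [List.nil_append, List.cons_append] at h1 h2
    simp only [oddIndicator, h1, h2]
  · have h1 := oddCount_congr 0 [] h (z :: l)
    have h2 := oddCount_congr 0 [z] h l
    simp only [List.nil_append, List.cons_append] at h1 h2
    simp only [oddIndicator, h1, h2]

/-- The explicit form of the `q`-quasi-polynomials of degree at most `d` and period at
most `2`. -/
theorem exists_coeff_of_mem_quasiPoly {d : ℕ} {f : ℤ → RatFunc ℚ} (hf : f ∈ quasiPoly d) :
    ∃ a b : ℕ → RatFunc ℚ, ∀ k : ℤ, f k =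
      ∑ m ∈ Finset.range (d + 1), (a m + (-1 : RatFunc ℚ) ^ k * b m) * q ^ ((m : ℤ) * k) := by
  induction hf using Submodule.span_induction with
  | mem f hf =>
    obtain ⟨ε, m, hm, rfl⟩ := hf
    have hq : ∀ k : ℤ, (q ^ m) ^ k = q ^ ((m : ℤ) * k) := fun k => by
      rw [zpow_mul, zpow_natCast]
    rcases Int.units_eq_one_or ε with rfl | rfl
    · refine ⟨fun i => if i = m then 1 else 0, 0, fun k => ?_⟩
      rw [Finset.sum_eq_single m] <;> simp +contextual [signedPow, hq]
      omega
    · refine ⟨0, fun i => if i = m then 1 else 0, fun k => ?_⟩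
      have h : ∀ k : ℤ, signedPow (-1) m ^ k = (-1) ^ k * q ^ ((m : ℤ) * k) := fun k => by
        rw [← hq, ← mul_zpow]
        simp [signedPow]
      rw [Finset.sum_eq_single m] <;> simp +contextual [h]
      omega
  | zero => exact ⟨0, 0, fun k => by simp⟩
  | add f g _ _ hf hg =>
    obtain ⟨a, b, h⟩ := hf
    obtain ⟨a', b', h'⟩ := hg
    refine ⟨a + a', b + b', fun k => ?_⟩
    rw [Pi.add_apply, h, h', ← Finset.sum_add_distrib]
    exact Finset.sum_congr rfl fun m _ => by simp only [Pi.add_apply]; ring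
  | smul r f _ hf =>
    obtain ⟨a, b, h⟩ := hf
    refine ⟨r • a, r • b, fun k => ?_⟩
    rw [Pi.smul_apply, h, smul_eq_mul, Finset.mul_sum]
    exact Finset.sum_congr rfl fun m _ => by simp only [Pi.smul_apply, smul_eq_mul]; ring

/-- The lists over which `nodeSum` sums. -/
noncomputable def interlacing : List ℤ → Finset (List ℤ)
  | [] => {[]}
  | [_] => {[]}
  | a :: b :: l =>
    ((Ioc a b ∪ Ioc b a) ×ˢ interlacing (b :: l)).image fun x => x.1 :: x.2

/-- The number of weak descents of a list. -/
def descents : List ℤ → ℕ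
  | [] => 0
  | [_] => 0
  | a :: b :: l => (if b ≤ a then 1 else 0) + descents (b :: l)

theorem qsum_eq_sum_union (a b : ℤ) (f : ℤ → RatFunc ℚ) :
    qsum a b f = ∑ x ∈ Ioc a b ∪ Ioc b a, (-1) ^ (if b ≤ a then 1 else 0) * (q ^ x * f x) := by
  rw [qsum]
  split_ifs with h
  · rw [Finset.Ioc_eq_empty (not_lt.mpr h)]
    simp
  · rw [Finset.Ioc_eq_empty (fun h' => h h'.le)]
    simp

theorem nodeSum_eq_sum (F : List ℤ → RatFunc ℚ) (l : List ℤ) :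
    nodeSum F l = ∑ m ∈ interlacing l, (-1) ^ descents l * (q ^ m.sum * F m) := by
  induction l generalizing F with
  | nil => simp [nodeSum, interlacing, descents]
  | cons a l ih =>
    cases l with
    | nil => simp [nodeSum, interlacing, descents]
    | cons b l =>
      rw [nodeSum_cons_cons, qsum_eq_sum_union, interlacing, Finset.sum_image, Finset.sum_product]
      · refine Finset.sum_congr rfl fun x _ => ?_
        rw [ih, Finset.mul_sum, Finset.mul_sum]
        refine Finset.sum_congr rfl fun m _ => ?_
        rw [descents, pow_add, List.sum_cons, zpow_add₀ q_ne_zero]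
        ring
      · rintro ⟨x, m⟩ _ ⟨y, m'⟩ _ h
        simpa using h

theorem mem_interlacing {a : ℤ} {l m : List ℤ} :
    m ∈ interlacing (a :: l) ↔ m.length = l.length ∧ ∀ t < m.length,
      m.getD t 0 ∈ Ioc ((a :: l).getD t 0) ((a :: l).getD (t + 1) 0) ∪
        Ioc ((a :: l).getD (t + 1) 0) ((a :: l).getD t 0) := by
  induction l generalizing a m with
  | nil =>
    simp only [interlacing, mem_singleton, List.length_nil, List.length_eq_zero_iff]
    constructor
    · rintro rfl
      simp
    · exact fun h => h.1
  | cons b l ih =>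
    rw [interlacing, mem_image]
    constructor
    · rintro ⟨⟨x, m⟩, h, rfl⟩
      rw [mem_product, ih] at h
      obtain ⟨h1, h2, h3⟩ := h
      refine ⟨by simpa using h2, fun t ht => ?_⟩
      cases t with
      | zero => simpa using h1
      | succ t => simpa using h3 t (by simpa using ht)
    · rintro ⟨h1, h2⟩
      cases m with
      | nil => simp at h1
      | cons x m =>
        refine ⟨(x, m), ?_, rfl⟩
        rw [mem_product, ih]
        refine ⟨by simpa using h2 0 (by simp), by simpa using h1, fun t ht => ?_⟩
        simpa using h2 (t + 1) (by simpa using ht)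

theorem descents_eq_sum (a : ℤ) (l : List ℤ) : descents (a :: l) =
    ∑ t ∈ Finset.range l.length,
      if (a :: l).getD (t + 1) 0 ≤ (a :: l).getD t 0 then 1 else 0 := by
  induction l generalizing a with
  | nil => simp [descents]
  | cons b l ih =>
    rw [descents, ih, List.length_cons, Finset.sum_range_succ', add_comm]
    simp

theorem oddCount_eq_sum (s : ℤ) (l : List ℤ) : oddCount s l =
    ∑ t ∈ Finset.range l.length, if Odd (l.getD t 0 - t - s) then 1 else 0 := by
  induction l generalizing s with
  | nil => simp [oddCount]
  | cons x l ih =>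
    rw [oddCount, ih, List.length_cons, Finset.sum_range_succ', add_comm]
    simp only [List.getD_cons_succ, List.getD_cons_zero, Nat.cast_add, Nat.cast_one,
      Nat.cast_zero, sub_zero]
    congr 1
    refine Finset.sum_congr rfl fun t _ => ?_
    rw [show l.getD t 0 - t - (s + 1) = l.getD t 0 - (t + 1) - s by ring]

theorem list_sum_eq_sum_getD (l : List ℤ) :
    l.sum = ∑ t ∈ Finset.range l.length, l.getD t 0 := by
  induction l with
  | nil => simp
  | cons x l ih =>
    rw [List.sum_cons, ih, List.length_cons, Finset.sum_range_succ', add_comm]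
    simp

/-- The row `i` of a pattern with shifted inner entries `l` and right boundary value `c`,
where `l` has length `n + 1 - i`. -/
def patRow (n c i : ℕ) (l : List ℤ) (j : ℕ) : ℤ :=
  if j = n + 1 then c
  else if i ≤ j ∧ j ≤ n then l.getD (j - i) 0 - (j - i : ℕ)
  else 0

theorem patRow_add {n i t : ℕ} (c : ℕ) (l : List ℤ) (h : i + t ≤ n) :
    patRow n c i l (i + t) = l.getD t 0 - t := by
  rw [patRow, if_neg (by omega), if_pos (by omega), Nat.add_sub_cancel_left]

theorem getD_cons_append_zero (a e : ℤ) (l : List ℤ) : (a :: l ++ [e]).getD 0 0 = a := rfl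

theorem getD_cons_append_succ (a e : ℤ) (l : List ℤ) {t : ℕ} (ht : t < l.length) :
    (a :: l ++ [e]).getD (t + 1) 0 = l.getD t 0 := by
  simp [List.getD_eq_getElem?_getD, List.getElem?_append_left ht]

theorem getD_cons_append_last (a e : ℤ) (l : List ℤ) :
    (a :: l ++ [e]).getD (l.length + 1) 0 = e := by
  simp [List.getD_eq_getElem?_getD]

/-- The nodes of `rowSum` in terms of the entries of a row. -/
theorem getD_nodes {n c r : ℕ} (hr : r + 1 ≤ n) {l : List ℤ} (hl : l.length = n - (r + 1))
    {t : ℕ} (ht : t ≤ n - r) :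
    (-1 :: l ++ [(c + n : ℕ) - ((r : ℤ) + 1)]).getD t 0 =
      patRow n c (r + 2) l (r + 1 + t) + t - 1 := by
  rcases t with _ | t
  · rw [getD_cons_append_zero, patRow, if_neg (by omega), if_neg (by omega)]
    simp
  · rcases Nat.lt_or_ge t l.length with h | h
    · rw [getD_cons_append_succ _ _ _ h, patRow, if_neg (by omega), if_pos (by omega),
        show r + 1 + (t + 1) - (r + 2) = t by omega]
      push_cast
      ring
    · obtain rfl : t = l.length := by omega
      rw [getD_cons_append_last, patRow, if_pos (by omega), hl]
      push_cast [Nat.cast_sub hr]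
      ring

/-- The condition on an entry of a row imposed by the two neighbouring entries of the
row above it. -/
def Between (x y z : ℤ) : Prop := (x ≤ y → x ≤ z ∧ z ≤ y) ∧ (y < x → y < z ∧ z < x)

theorem isPattern_succ_iff {r n c : ℕ} {a : ℕ → ℕ → ℤ} :
    IsPattern (r + 1) n c a ↔ IsPattern r n c (Function.update a (r + 2) 0) ∧
      (a (r + 2) (r + 1) = 0 ∧ a (r + 2) (n + 1) = c) ∧
      (∀ j, j < r + 1 ∨ n + 1 < j → a (r + 2) j = 0) ∧
      ∀ j, r + 1 ≤ j → j ≤ n → Between (a (r + 2) j) (a (r + 2) (j + 1)) (a (r + 1) j) := by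
  constructor
  · rintro ⟨h1, h2, h3⟩
    refine ⟨⟨fun i hi hi' => ?_, fun i j hi hi' hj hj' => ?_, fun i j hij => ?_⟩,
      h1 (r + 2) (by omega) (by omega), fun j hj => h3 _ _ (by omega), fun j hj hj' => ?_⟩
    · rw [Function.update_of_ne (by omega)]
      exact h1 i hi (by omega)
    · rw [Function.update_of_ne (by omega), Function.update_of_ne (by omega)]
      exact h2 i j hi (by omega) hj hj'
    · by_cases h : i = r + 2
      · subst h
        simp
      · rw [Function.update_of_ne h]
        exact h3 i j (by omega)
    · exact h2 (r + 2) j (by omega) le_rfl (by omega) hj'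
  · rintro ⟨⟨h1, h2, h3⟩, h4, h5, h6⟩
    refine ⟨fun i hi hi' => ?_, fun i j hi hi' hj hj' => ?_, fun i j hij => ?_⟩
    · by_cases h : i = r + 2
      · subst h
        exact h4
      · have := h1 i hi (by omega)
        rwa [Function.update_of_ne h] at this
    · by_cases h : i = r + 2
      · subst h
        exact h6 j (by omega) hj'
      · have := h2 i j hi (by omega) hj hj'
        rwa [Function.update_of_ne h, Function.update_of_ne (by omega)] at this
    · by_cases h : i = r + 2
      · subst h
        exact h5 j (by omega)
      · have := h3 i j (by omega)
        rwa [Function.update_of_ne h] at this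

theorem IsPattern.row_eq {r n c : ℕ} {a : ℕ → ℕ → ℤ} (h : IsPattern r n c a) (hr : r ≤ n) :
    a (r + 1) = patRow n c (r + 1)
      ((List.range (n - r)).map fun t => a (r + 1) (r + 1 + t) + t) := by
  obtain ⟨h1, -, h3⟩ := h
  ext j
  rw [patRow]
  split_ifs with h h'
  · subst h
    exact (h1 (r + 1) (by omega) le_rfl).2
  · have : j - (r + 1) < n - r := by omega
    simp [List.getD_eq_getElem?_getD, List.getElem?_range this,
      show r + 1 + (j - (r + 1)) = j by omega]
  · by_cases hj : j = r
    · subst hj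
      exact (h1 (j + 1) (by omega) le_rfl).1
    · exact h3 _ _ (by omega)

theorem patRow_injective {r n c : ℕ} {l m : List ℤ} (hl : l.length = n - r)
    (hm : m.length = n - r) (h : patRow n c (r + 1) l = patRow n c (r + 1) m) : l = m := by
  refine List.ext_getElem (by omega) fun t ht ht' => ?_
  have := congrFun h (r + 1 + t)
  rw [patRow_add _ _ (by omega), patRow_add _ _ (by omega)] at this
  simpa [List.getD_eq_getElem?_getD, ht, ht'] using this

theorem sum_patRow {r n c : ℕ} {l : List ℤ} (hl : l.length = n - r) :
    ∑ j ∈ Finset.Icc (r + 1) n, patRow n c (r + 1) l j =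
      l.sum - ∑ t ∈ Finset.range (n - r), (t : ℤ) := by
  rw [list_sum_eq_sum_getD, hl, ← Finset.sum_sub_distrib, ← Finset.Ico_add_one_right_eq_Icc,
    Finset.sum_Ico_eq_sum_range, show n + 1 - (r + 1) = n - r by omega]
  refine Finset.sum_congr rfl fun t ht => ?_
  rw [mem_range] at ht
  exact patRow_add _ _ (by omega)

theorem ncard_eq_sum {s : Finset ℕ} {S : Set ℕ} {P : ℕ → Prop} [DecidablePred P]
    (h : ∀ j, j ∈ S ↔ j ∈ s ∧ P j) : S.ncard = ∑ j ∈ s, if P j then 1 else 0 := by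
  rw [Finset.sum_boole, Nat.cast_id, ← Set.ncard_coe_finset]
  congr 1
  ext j
  simp [h]

theorem oddTop_eq_oddCount {n c : ℕ} {a : ℕ → ℕ → ℤ} {l : List ℤ} (hl : l.length = n)
    (ha : a 1 = patRow n c 1 l) : oddTop n a = oddCount 0 l := by
  rw [oddTop, ncard_eq_sum (s := Finset.Ico 1 (n + 1)) (P := fun j => Odd (a 1 j)),
    Finset.sum_Ico_eq_sum_range, oddCount_eq_sum, hl, Nat.add_sub_cancel]
  · refine Finset.sum_congr rfl fun t ht => ?_
    rw [mem_range] at ht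
    rw [ha, patRow_add _ _ (by omega), sub_zero]
  · intro j
    simp only [Set.mem_ofPred_eq, mem_Ico, Nat.lt_add_one_iff, and_assoc]

theorem invCount_succ {r n c : ℕ} {a : ℕ → ℕ → ℤ} {l : List ℤ} (hr : r + 1 ≤ n)
    (hl : l.length = n - (r + 1)) :
    invCount (r + 1) n (Function.update a (r + 2) (patRow n c (r + 2) l)) =
      invCount r n a + descents (-1 :: l ++ [(c + n : ℕ) - ((r : ℤ) + 1)]) := by
  set ρ := patRow n c (r + 2) l with hρ
  set D : Set ℕ := {j | r + 1 ≤ j ∧ j ≤ n ∧ ρ (j + 1) < ρ j} with hD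
  set A : Set (ℕ × ℕ) := {ij : ℕ × ℕ | 2 ≤ ij.1 ∧ ij.1 ≤ r + 1 ∧ ij.1 ≤ ij.2 + 1 ∧ ij.2 ≤ n ∧
    a ij.1 (ij.2 + 1) < a ij.1 ij.2} with hA
  have hfin : A.Finite := by
    refine ((Set.finite_Iic (r + 1)).prod (Set.finite_Iic n)).subset ?_
    rintro ⟨i, j⟩ ⟨-, h1, -, h2, -⟩
    exact ⟨h1, h2⟩
  have hDfin : D.Finite := (Set.finite_Iic n).subset fun j hj => hj.2.1
  have hunion : {ij : ℕ × ℕ | 2 ≤ ij.1 ∧ ij.1 ≤ r + 1 + 1 ∧ ij.1 ≤ ij.2 + 1 ∧ ij.2 ≤ n ∧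
      Function.update a (r + 2) ρ ij.1 (ij.2 + 1) < Function.update a (r + 2) ρ ij.1 ij.2} =
      A ∪ Prod.mk (r + 2) '' D := by
    ext ⟨i, j⟩
    simp only [Set.mem_ofPred_eq, Set.mem_union, Set.mem_image, Prod.mk.injEq, hA, hD]
    by_cases h : i = r + 2
    · subst h
      simp
    · rw [Function.update_of_ne h]
      constructor
      · rintro ⟨h1, h2, h3⟩
        exact Or.inl ⟨h1, by omega, h3⟩
      · rintro (⟨h1, h2, h3⟩ | ⟨_, _, h1, _⟩)
        · exact ⟨h1, by omega, h3⟩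
        · exact absurd h1.symm h
  have hdisj : Disjoint A (Prod.mk (r + 2) '' D) := by
    rw [Set.disjoint_left]
    rintro _ ⟨-, h1, -⟩ ⟨j, -, rfl⟩
    simp at h1
  rw [invCount, hunion, Set.ncard_union_eq hdisj hfin (hDfin.image _),
    Set.ncard_image_of_injective _ (Prod.mk_right_injective _)]
  congr 1
  rw [ncard_eq_sum (s := Finset.Ico (r + 1) (n + 1)) (P := fun j => ρ (j + 1) < ρ j),
    Finset.sum_Ico_eq_sum_range, List.cons_append, descents_eq_sum, ← List.cons_append]
  · have hlen : (l ++ [((c + n : ℕ) : ℤ) - ((r : ℤ) + 1)]).length = n + 1 - (r + 1) := by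
      rw [List.length_append, hl, List.length_singleton]
      omega
    rw [hlen]
    refine Finset.sum_congr rfl fun t ht => ?_
    rw [mem_range] at ht
    rw [getD_nodes hr hl (by omega), getD_nodes hr hl (by omega), ← hρ]
    refine if_congr ?_ rfl rfl
    rw [show r + 1 + (t + 1) = r + 1 + t + 1 by ring]
    push_cast
    omega
  · intro j
    simp only [hD, Set.mem_ofPred_eq, mem_Ico]
    omega

theorem patNorm_succ {r n : ℕ} (a : ℕ → ℕ → ℤ) (ρ : ℕ → ℤ) :
    patNorm (r + 1) n (Function.update a (r + 2) ρ) =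
      patNorm r n a + ∑ j ∈ Finset.Icc (r + 2) n, ρ j := by
  rw [patNorm, Finset.sum_Icc_succ_top (by omega), Function.update_self, patNorm]
  congr 1
  refine Finset.sum_congr rfl fun i hi => ?_
  rw [mem_Icc] at hi
  rw [Function.update_of_ne (by omega)]

theorem mem_interlacing_nodes {r n c : ℕ} {l m : List ℤ} (hr : r + 1 ≤ n)
    (hl : l.length = n - (r + 1)) (hm : m.length = n - r) :
    m ∈ interlacing (-1 :: l ++ [(c + n : ℕ) - ((r : ℤ) + 1)]) ↔
      ∀ j, r + 1 ≤ j → j ≤ n → Between (patRow n c (r + 2) l j) (patRow n c (r + 2) l (j + 1))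
        (patRow n c (r + 1) m j) := by
  rw [List.cons_append, mem_interlacing, ← List.cons_append]
  have key : ∀ t < n - r, (m.getD t 0 ∈
      Ioc ((-1 :: l ++ [(c + n : ℕ) - ((r : ℤ) + 1)]).getD t 0)
        ((-1 :: l ++ [(c + n : ℕ) - ((r : ℤ) + 1)]).getD (t + 1) 0) ∪
      Ioc ((-1 :: l ++ [(c + n : ℕ) - ((r : ℤ) + 1)]).getD (t + 1) 0)
        ((-1 :: l ++ [(c + n : ℕ) - ((r : ℤ) + 1)]).getD t 0)) ↔
      Between (patRow n c (r + 2) l (r + 1 + t)) (patRow n c (r + 2) l (r + 1 + t + 1))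
        (patRow n c (r + 1) m (r + 1 + t)) := by
    intro t ht
    have hm' : patRow n c (r + 1) m (r + 1 + t) = m.getD t 0 - t :=
      patRow_add _ _ (by omega)
    rw [getD_nodes hr hl (by omega), getD_nodes hr hl (by omega), hm', Between,
      show r + 1 + (t + 1) = r + 1 + t + 1 by ring]
    simp only [mem_union, mem_Ioc]
    push_cast
    omega
  constructor
  · rintro ⟨-, h⟩ j hj hj'
    obtain ⟨t, rfl⟩ := Nat.exists_eq_add_of_le hj
    exact (key t (by omega)).mp (h t (by omega))
  · intro h
    refine ⟨?_, fun t ht => (key t (by omega)).mpr (h _ (by omega) (by omega))⟩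
    rw [List.length_append, hl, hm, List.length_singleton]
    omega

/-- The contribution of a pattern to the generating function. -/
noncomputable def patWeight (r n p : ℕ) (a : ℕ → ℕ → ℤ) : RatFunc ℚ :=
  if oddTop n a = p then patSign r n a * q ^ patNorm r n a else 0

theorem oddTop_update {n i : ℕ} (a : ℕ → ℕ → ℤ) (ρ : ℕ → ℤ) (hi : i ≠ 1) :
    oddTop n (Function.update a i ρ) = oddTop n a := by
  rw [oddTop, oddTop, Function.update_of_ne hi.symm]

theorem patWeight_succ {r n c p : ℕ} {a : ℕ → ℕ → ℤ} {l : List ℤ} (hr : r + 1 ≤ n)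
    (hl : l.length = n - (r + 1)) :
    patWeight (r + 1) n p (Function.update a (r + 2) (patRow n c (r + 2) l)) =
      q ^ (l.sum - ∑ t ∈ Finset.range (n - (r + 1)), (t : ℤ)) *
        ((-1) ^ descents (-1 :: l ++ [(c + n : ℕ) - ((r : ℤ) + 1)]) * patWeight r n p a) := by
  rw [patWeight, patWeight, oddTop_update _ _ (by omega), patSign, patSign, invCount_succ hr hl,
    patNorm_succ, sum_patRow hl]
  split_ifs with h
  · rw [pow_add, zpow_add₀ q_ne_zero]
    ring
  · simp

theorem isPattern_zero_iff {n c : ℕ} {a : ℕ → ℕ → ℤ} {l : List ℤ} :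
    (IsPattern 0 n c a ∧ a 1 = patRow n c 1 l) ↔
      a = Function.update (0 : ℕ → ℕ → ℤ) 1 (patRow n c 1 l) := by
  constructor
  · rintro ⟨⟨-, -, h⟩, h'⟩
    ext i j
    by_cases hi : i = 1
    · subst hi
      rw [h', Function.update_self]
    · rw [Function.update_of_ne hi, h i j (by omega)]
      rfl
  · rintro rfl
    refine ⟨⟨fun i hi hi' => ?_, fun i j hi hi' => by omega, fun i j hij => ?_⟩,
      Function.update_self _ _ _⟩
    · obtain rfl : i = 1 := by omega
      simp [patRow]
    · by_cases hi : i = 1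
      · subst hi
        rw [Function.update_self, patRow, if_neg (by omega), if_neg (by omega)]
      · rw [Function.update_of_ne hi]
        rfl

theorem isPattern_update_iff {r n c : ℕ} {a : ℕ → ℕ → ℤ} {l m : List ℤ} (hr : r + 1 ≤ n)
    (hl : l.length = n - (r + 1)) (hm : m.length = n - r)
    (ha : IsPattern r n c a) (har : a (r + 1) = patRow n c (r + 1) m) :
    IsPattern (r + 1) n c (Function.update a (r + 2) (patRow n c (r + 2) l)) ↔
      m ∈ interlacing (-1 :: l ++ [(c + n : ℕ) - ((r : ℤ) + 1)]) := by
  have h0 : a (r + 2) = 0 := funext fun j => ha.2.2 _ _ (by omega)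
  rw [isPattern_succ_iff, Function.update_idem, ← h0, Function.update_eq_self,
    Function.update_self, Function.update_of_ne (by omega), har, mem_interlacing_nodes hr hl hm]
  refine ⟨fun h => h.2.2.2, fun h => ⟨ha, ⟨?_, ?_⟩, fun j hj => ?_, h⟩⟩
  · rw [patRow, if_neg (by omega), if_neg (by omega)]
  · rw [patRow, if_pos rfl]
  · rw [patRow, if_neg (by omega), if_neg (by omega)]

/-- The patterns with a given top row form a finite set, and their generating function
is an iterated row sum. -/
theorem exists_patterns_sum (n c p r : ℕ) (hr : r ≤ n) : ∃ κ : RatFunc ℚ, ∀ l : List ℤ,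
    l.length = n - r → ∃ S : Finset (ℕ → ℕ → ℤ),
      (∀ a, a ∈ S ↔ IsPattern r n c a ∧ a (r + 1) = patRow n c (r + 1) l) ∧
      ∑ a ∈ S, patWeight r n p a =
        κ * (q ^ l.sum * iterRowSum (oddIndicator p) (c + n : ℕ) r l) := by
  classical
  induction r with
  | zero =>
    refine ⟨q ^ (-∑ t ∈ Finset.range n, (t : ℤ)), fun l hl =>
      ⟨{Function.update (0 : ℕ → ℕ → ℤ) 1 (patRow n c 1 l)}, fun a => ?_, ?_⟩⟩
    · rw [mem_singleton, zero_add, isPattern_zero_iff]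
    · have h1 : oddTop n (Function.update (0 : ℕ → ℕ → ℤ) 1 (patRow n c 1 l)) = oddCount 0 l :=
        oddTop_eq_oddCount hl (Function.update_self _ _ _)
      have h2 : invCount 0 n (Function.update (0 : ℕ → ℕ → ℤ) 1 (patRow n c 1 l)) = 0 := by
        refine (congrArg Set.ncard (Set.eq_empty_iff_forall_notMem.mpr ?_)).trans
          (Set.ncard_empty _)
        rintro x ⟨hx, hx', -⟩
        omega
      have h3 : patNorm 0 n (Function.update (0 : ℕ → ℕ → ℤ) 1 (patRow n c 1 l)) =
          l.sum - ∑ t ∈ Finset.range n, (t : ℤ) := by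
        rw [patNorm, zero_add, Finset.Icc_self, Finset.sum_singleton, Function.update_self]
        exact sum_patRow (r := 0) hl
      rw [Finset.sum_singleton, patWeight, h1, patSign, h2, h3, iterRowSum, oddIndicator,
        sub_eq_add_neg, zpow_add₀ q_ne_zero]
      split_ifs
      · ring
      · simp
  | succ r ih =>
    obtain ⟨κ, hκ⟩ := ih (by omega)
    refine ⟨κ * q ^ (-∑ t ∈ Finset.range (n - (r + 1)), (t : ℤ)), fun l hl => ?_⟩
    choose! S hS hsum using hκ
    set N : List ℤ := -1 :: l ++ [(c + n : ℕ) - ((r : ℤ) + 1)] with hN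
    set ρ := patRow n c (r + 2) l with hρ
    have hlen : ∀ m ∈ interlacing N, m.length = n - r := by
      intro m hm
      rw [hN, List.cons_append, mem_interlacing, List.length_append, List.length_singleton,
        hl] at hm
      omega
    have hzero : ∀ m ∈ interlacing N, ∀ a ∈ S m, a (r + 2) = 0 := fun m hm a ha =>
      funext fun j => ((hS m (hlen m hm) a).mp ha).1.2.2 _ _ (by omega)
    refine ⟨(interlacing N).biUnion fun m => (S m).image fun a => Function.update a (r + 2) ρ,
      fun a => ?_, ?_⟩
    · simp only [mem_biUnion, mem_image]
      constructor
      · rintro ⟨m, hm, a, ha, rfl⟩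
        have h := (hS m (hlen m hm) a).mp ha
        exact ⟨(isPattern_update_iff (by omega) hl (hlen m hm) h.1 h.2).mpr hm,
          Function.update_self _ _ _⟩
      · rintro ⟨ha, har⟩
        replace har : a (r + 2) = ρ := har
        have ha' := (isPattern_succ_iff.mp ha).1
        have hupd : Function.update (Function.update a (r + 2) 0) (r + 2) ρ = a := by
          rw [Function.update_idem, ← har, Function.update_eq_self]
        have hrow := ha'.row_eq (by omega)
        set m := (List.range (n - r)).map fun t =>
          Function.update a (r + 2) 0 (r + 1) (r + 1 + t) + t with hm
        have hmlen : m.length = n - r := by simp [hm]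
        refine ⟨m, ?_, Function.update a (r + 2) 0, (hS m hmlen _).mpr ⟨ha', hrow⟩, hupd⟩
        rw [hN, ← isPattern_update_iff (by omega) hl hmlen ha' hrow, ← hρ, hupd]
        exact ha
    · rw [Finset.sum_biUnion]
      · have step : ∀ m ∈ interlacing N,
            ∑ a ∈ (S m).image (fun a => Function.update a (r + 2) ρ), patWeight (r + 1) n p a =
              κ * q ^ (l.sum - ∑ t ∈ Finset.range (n - (r + 1)), (t : ℤ)) *
                ((-1) ^ descents N *
                  (q ^ m.sum * iterRowSum (oddIndicator p) (c + n : ℕ) r m)) := by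
          intro m hm
          rw [Finset.sum_image]
          · simp only [hρ, patWeight_succ hr hl]
            rw [← Finset.mul_sum, ← Finset.mul_sum, hsum m (hlen m hm)]
            ring
          · intro a ha b hb hab
            have := congrArg (fun x => Function.update x (r + 2) 0) hab
            simp only [Function.update_idem] at this
            rwa [← hzero m hm a ha, Function.update_eq_self, hzero m hm a ha,
              ← hzero m hm b hb, Function.update_eq_self] at this
        rw [Finset.sum_congr rfl step, ← Finset.mul_sum, ← nodeSum_eq_sum, iterRowSum, rowSum,
          ← hN, sub_eq_add_neg, zpow_add₀ q_ne_zero]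
        ring
      · intro m hm m' hm' hne
        rw [Function.onFun, Finset.disjoint_left]
        intro a ha ha'
        obtain ⟨b, hb, rfl⟩ := mem_image.mp ha
        obtain ⟨b', hb', hbb⟩ := mem_image.mp ha'
        have := congrFun hbb (r + 1)
        rw [Function.update_of_ne (by omega), Function.update_of_ne (by omega),
          ((hS m (hlen m hm) b).mp hb).2, ((hS m' (hlen m' hm') b').mp hb').2] at this
        exact hne (patRow_injective (hlen m hm) (hlen m' hm') this.symm)

theorem exists_Fq_eq (n c p : ℕ) (hn : 1 ≤ n) : ∃ κ : RatFunc ℚ, ∀ k : ℤ,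
    Fq n c p k = κ * iterRowSum (oddIndicator p) (c + n : ℕ) (n - 1) [k] := by
  obtain ⟨r, rfl⟩ := Nat.exists_eq_add_of_le' hn
  obtain ⟨κ, hκ⟩ := exists_patterns_sum (r + 1) c p r (by omega)
  refine ⟨κ, fun k => ?_⟩
  obtain ⟨S, hS, hsum⟩ := hκ [k] (by simp)
  rw [List.sum_singleton] at hsum
  have hset : {a : ℕ → ℕ → ℤ | IsPattern (r + 1 - 1) (r + 1) c a ∧ a (r + 1) (r + 1) = k ∧
      oddTop (r + 1) a = p} = (S.filter fun a => oddTop (r + 1) a = p) := by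
    ext a
    rw [Finset.coe_filter, Set.mem_ofPred_eq, Set.mem_ofPred_eq, hS, Nat.add_sub_cancel]
    have key : IsPattern r (r + 1) c a →
        (a (r + 1) (r + 1) = k ↔ a (r + 1) = patRow (r + 1) c (r + 1) [k]) := by
      intro h
      constructor
      · rintro rfl
        have := h.row_eq (by omega)
        simpa using this
      · intro h
        rw [h]
        simpa using patRow_add (i := r + 1) (t := 0) c [k] le_rfl
    constructor
    · rintro ⟨h1, h2, h3⟩
      exact ⟨⟨h1, (key h1).mp h2⟩, h3⟩
    · rintro ⟨⟨h1, h2⟩, h3⟩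
      exact ⟨h1, (key h1).mpr h2, h3⟩
  rw [Fq, hset, finsum_mem_coe_finset, Finset.sum_filter, Nat.add_sub_cancel]
  have : ∑ a ∈ S, (if oddTop (r + 1) a = p then
      patSign r (r + 1) a * q ^ patNorm r (r + 1) a else 0) = ∑ a ∈ S, patWeight r (r + 1) p a :=
    rfl
  rw [this, hsum]
  have hq : q ^ k ≠ 0 := zpow_ne_zero _ q_ne_zero
  field_simp

/-- **Corollary 1.** `F_q(n-1,n,c,p;k)` is a `q`-quasi-polynomial in `k` of degree at
most `2n-2` and period at most `2`. -/
theorem statement9 (n c p : ℕ) (hn : 1 ≤ n) (hp : p ≤ n) :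
    ∃ a b : ℕ → RatFunc ℚ, ∀ k : ℤ,
      Fq n c p k =
        ∑ m ∈ Finset.range (2 * n - 1),
          (a m + (-1 : RatFunc ℚ) ^ k * b m) * q ^ ((m : ℤ) * k) := by
  obtain ⟨κ, hκ⟩ := exists_Fq_eq n c p hn
  have h := (quasiPoly (2 * (n - 1))).smul_mem κ
    (entryDegLE_iterRowSum_oddIndicator p (c + n : ℕ) (n - 1) [] [])
  obtain ⟨a, b, hab⟩ := exists_coeff_of_mem_quasiPoly h
  refine ⟨a, b, fun k => ?_⟩
  rw [hκ, show 2 * n - 1 = 2 * (n - 1) + 1 by omega, ← hab k]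
  rfl
end

section
/- Let n ≥ 1, c ≥ 0 and 0 ≤ p ≤ n−1 be integers. Then F_q(n−1,n,c,p;0) = G_{n−1,c,p} in ℚ(q). -/
open Finset

/-- A strict plane partition: entries `part i j` (row `i`, column `j`, both 0-indexed),
zero outside the shape; rows weakly decrease and columns strictly decrease on the shape. -/
structure SPP where
  part : ℕ → ℕ → ℕ
  supp_finite : {ij : ℕ × ℕ | part ij.1 ij.2 ≠ 0}.Finite
  row_decr : ∀ i j₁ j₂, j₁ ≤ j₂ → part i j₂ ≤ part i j₁
  col_strict : ∀ i j, part (i + 1) j ≠ 0 → part (i + 1) j < part i j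

/-- The norm of a strict plane partition: the sum of its parts. -/
noncomputable def sppNorm (P : SPP) : ℕ := ∑ᶠ ij : ℕ × ℕ, P.part ij.1 ij.2

/-- The length of the `i`-th row (0-indexed), i.e. the part `λ_{i+1}` of the shape. -/
noncomputable def rowLen (P : SPP) (i : ℕ) : ℕ := {j | P.part i j ≠ 0}.ncard

/-- The number of rows of odd length. -/
noncomputable def oddRows (P : SPP) : ℕ := {i | Odd (rowLen P i)}.ncard

/-- The number of parts equal to `n`. -/
noncomputable def eqCount (P : SPP) (n : ℕ) : ℕ := {ij : ℕ × ℕ | P.part ij.1 ij.2 = n}.ncard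

/-- `Gspp n c p` is `G_{n,c,p}`: the generating function of strict plane partitions with
parts in `{1,…,n}`, at most `c` columns and exactly `p` rows of odd length. -/
noncomputable def Gspp (n c p : ℕ) : RatFunc ℚ :=
  ∑ᶠ P ∈ {P : SPP | (∀ i j, P.part i j ≤ n) ∧ (∀ i j, c ≤ j → P.part i j = 0) ∧
      oddRows P = p}, q ^ sppNorm P

theorem lt_card_filter_range_iff {s : ℕ → Prop} [DecidablePred s] {c : ℕ}
    (hs : ∀ l m, l ≤ m → s m → s l) (hc : ∀ l, s l → l < c) (l : ℕ) :
    l < #{m ∈ range c | s m} ↔ s l := by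
  constructor
  · intro h
    by_contra hl
    have hsub : ({m ∈ range c | s m} : Finset ℕ) ⊆ range l := by
      intro m hm
      simp only [mem_filter, mem_range] at hm ⊢
      by_contra hlm
      exact hl (hs l m (by omega) hm.2)
    have := card_le_card hsub
    rw [card_range] at this
    omega
  · intro h
    have hsub : range (l + 1) ⊆ ({m ∈ range c | s m} : Finset ℕ) := by
      intro m hm
      have hm' := hs m l (by simpa [Nat.lt_succ_iff] using hm) h
      simpa using ⟨hc m hm', hm'⟩
    have := card_le_card hsub
    rw [card_range] at this
    omega

/-- Columns decrease strictly, so a part bounded by `m - 1` in row `0` forces the bound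
`m - 1 - k` in row `k`. -/
theorem SPP.part_add_lt {P : SPP} {m : ℕ} (hP : ∀ i j, P.part i j < m) {k l : ℕ}
    (h : P.part k l ≠ 0) : P.part k l + k < m := by
  induction k with
  | zero => exact hP 0 l
  | succ k ih =>
    have h1 := P.col_strict k l h
    have h2 := ih (by omega)
    omega

/-- The pattern of a strict plane partition: row `i` lists, in reverse order, the lengths of the
rows of the shape formed by the parts that are at least `i`. -/
def SPP.toPattern (n c : ℕ) (P : SPP) (i j : ℕ) : ℤ :=
  if 1 ≤ i ∧ i ≤ n then
    if j ≤ n then (#{l ∈ range c | i ≤ P.part (n - j) l} : ℕ) else if j = n + 1 then c else 0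
  else 0

namespace SPP

variable {n c : ℕ} {P : SPP}

theorem toPattern_of_le {i j : ℕ} (hi : 1 ≤ i) (hin : i ≤ n) (hj : j ≤ n) :
    P.toPattern n c i j = (#{l ∈ range c | i ≤ P.part (n - j) l} : ℕ) := by
  simp [toPattern, hi, hin, hj]

theorem toPattern_last {i : ℕ} (hi : 1 ≤ i) (hin : i ≤ n) :
    P.toPattern n c i (n + 1) = c := by
  simp [toPattern, hi, hin]

theorem toPattern_eq_zero (hP : ∀ i j, P.part i j < n) {i j : ℕ} (hi : 1 ≤ i) (hin : i ≤ n)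
    (hji : j ≤ i) : P.toPattern n c i j = 0 := by
  rw [toPattern_of_le hi hin (by omega), Nat.cast_eq_zero, card_eq_zero, filter_eq_empty_iff]
  intro l _ h
  have := part_add_lt hP (k := n - j) (l := l) (by omega)
  omega

theorem toPattern_interlace {i j : ℕ} (hi : 2 ≤ i) (hin : i ≤ n) (hj : j ≤ n) :
    P.toPattern n c i j ≤ P.toPattern n c (i - 1) j ∧
      P.toPattern n c (i - 1) j ≤ P.toPattern n c i (j + 1) := by
  rw [toPattern_of_le (by omega) hin hj, toPattern_of_le (by omega) (by omega) hj]
  constructor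
  · rw [Nat.cast_le]
    refine card_le_card (monotone_filter_right _ ?_)
    intro l _ h
    omega
  · rcases hj.eq_or_lt with rfl | hj'
    · rw [toPattern_last (by omega) hin, Nat.cast_le]
      exact (card_filter_le _ _).trans (card_range c).le
    · rw [toPattern_of_le (by omega) hin (by omega), Nat.cast_le]
      refine card_le_card (monotone_filter_right _ ?_)
      intro l _ (h : i - 1 ≤ P.part (n - j) l)
      have h1 : n - j = n - (j + 1) + 1 := by omega
      have h2 := P.col_strict (n - (j + 1)) l
      rw [← h1] at h2
      have := h2 (by omega)
      omega

theorem isPattern_toPattern (hn : 1 ≤ n) (hP : ∀ i j, P.part i j < n) :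
    IsPattern (n - 1) n c (P.toPattern n c) := by
  refine ⟨fun i hi hin => ⟨toPattern_eq_zero hP hi (by omega) (by omega),
    toPattern_last hi (by omega)⟩, fun i j hi hin hij hj => ?_, fun i j h => ?_⟩
  · have := P.toPattern_interlace (n := n) (c := c) hi (by omega) hj
    exact ⟨fun _ => this, fun h => by omega⟩
  · by_cases hi : 1 ≤ i ∧ i ≤ n
    · rcases Nat.lt_or_ge (n + 1) j with hj | hj
      · simp only [toPattern, hi, and_self, if_true]
        rw [if_neg (by omega), if_neg (by omega)]
      · exact toPattern_eq_zero hP hi.1 hi.2 (by omega)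
    · exact if_neg hi

theorem lt_toPattern_iff (hc : ∀ i j, c ≤ j → P.part i j = 0) {i k l : ℕ}
    (hi : 1 ≤ i) (hin : i ≤ n) (hk : k ≤ n) :
    (l : ℤ) < P.toPattern n c i (n - k) ↔ i ≤ P.part k l := by
  rw [toPattern_of_le hi hin (by omega), Nat.cast_lt, lt_card_filter_range_iff, Nat.sub_sub_self hk]
  · exact fun l m hlm h => h.trans (P.row_decr _ _ _ hlm)
  · intro l h
    by_contra hl
    have := hc (n - (n - k)) l (by omega)
    omega

theorem toPattern_injOn :
    Set.InjOn (toPattern n c)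
      {P : SPP | (∀ i j, P.part i j < n) ∧ ∀ i j, c ≤ j → P.part i j = 0} := by
  intro P hP Q hQ h
  have hPQ : P.part = Q.part := by
    funext k l
    rcases Nat.lt_or_ge n k with hk | hk
    · have hP0 : P.part k l = 0 := by
        by_contra h0
        have := part_add_lt hP.1 h0
        omega
      have hQ0 : Q.part k l = 0 := by
        by_contra h0
        have := part_add_lt hQ.1 h0
        omega
      rw [hP0, hQ0]
    · have key : ∀ i, 1 ≤ i → i ≤ n → (i ≤ P.part k l ↔ i ≤ Q.part k l) := fun i hi hin => by
        rw [← lt_toPattern_iff hP.2 hi hin hk, ← lt_toPattern_iff hQ.2 hi hin hk, h]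
      have hP1 := hP.1 k l
      have hQ1 := hQ.1 k l
      have h1 := key (P.part k l)
      have h2 := key (Q.part k l)
      omega
  cases P
  cases Q
  congr

theorem invCount_toPattern (hn : 1 ≤ n) :
    invCount (n - 1) n (P.toPattern n c) = 0 := by
  have : {ij : ℕ × ℕ | 2 ≤ ij.1 ∧ ij.1 ≤ n - 1 + 1 ∧ ij.1 ≤ ij.2 + 1 ∧ ij.2 ≤ n ∧
      P.toPattern n c ij.1 (ij.2 + 1) < P.toPattern n c ij.1 ij.2} = ∅ := by
    rw [Set.eq_empty_iff_forall_notMem]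
    rintro ⟨i, j⟩ ⟨hi, hin, -, hj, h⟩
    have := P.toPattern_interlace (n := n) (c := c) hi (by omega) hj
    exact h.not_ge (this.1.trans this.2)
  rw [invCount, this, Set.ncard_empty]

theorem rowLen_eq_toPattern (hn : 1 ≤ n) (hc : ∀ i j, c ≤ j → P.part i j = 0) {k : ℕ}
    (hk : k ≤ n) : (rowLen P k : ℤ) = P.toPattern n c 1 (n - k) := by
  rw [toPattern_of_le le_rfl hn (by omega), Nat.cast_inj, rowLen, Nat.sub_sub_self hk,
    ← Set.ncard_coe_finset]
  congr 1
  ext l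
  simp only [Set.mem_ofPred_eq, coe_filter, mem_range, Nat.one_le_iff_ne_zero]
  refine ⟨fun h => ⟨?_, h⟩, fun h => h.2⟩
  by_contra hl
  exact h (hc k l (by omega))

theorem oddTop_toPattern (hn : 1 ≤ n) (hP : ∀ i j, P.part i j < n)
    (hc : ∀ i j, c ≤ j → P.part i j = 0) : oddTop n (P.toPattern n c) = oddRows P := by
  have himage : {i | Odd (rowLen P i)} =
      (fun j => n - j) '' {j | 1 ≤ j ∧ j ≤ n ∧ Odd (P.toPattern n c 1 j)} := by
    ext k
    simp only [Set.mem_ofPred_eq, Set.mem_image]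
    constructor
    · intro h
      have hk : k < n := by
        by_contra hk
        have h0 : ∀ l, P.part k l = 0 := fun l => by
          by_contra h0
          have := part_add_lt hP h0
          omega
        simp [rowLen, h0] at h
      refine ⟨n - k, ⟨by omega, by omega, ?_⟩, by omega⟩
      rw [← rowLen_eq_toPattern hn hc hk.le]
      exact_mod_cast h
    · rintro ⟨j, ⟨hj, hjn, h⟩, rfl⟩
      rw [← Nat.sub_sub_self hjn, ← rowLen_eq_toPattern hn hc (by omega)] at h
      exact_mod_cast h
  rw [oddTop, oddRows, himage, Set.InjOn.ncard_image]
  rintro j ⟨-, hj, -⟩ j' ⟨-, hj', -⟩ h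
  dsimp only at h
  omega

theorem sppNorm_eq_sum (hP : ∀ i j, P.part i j < n) (hc : ∀ i j, c ≤ j → P.part i j = 0) :
    sppNorm P = ∑ k ∈ range n, ∑ l ∈ range c, P.part k l := by
  rw [sppNorm, ← sum_product']
  refine finsum_eq_sum_of_support_subset _ ?_
  rintro ⟨k, l⟩ h
  simp only [Function.mem_support] at h
  simp only [coe_product, Set.mem_prod, mem_coe, mem_range]
  refine ⟨?_, ?_⟩
  · have := part_add_lt hP h
    omega
  · by_contra hl
    exact h (hc k l (by omega))

theorem patNorm_toPattern (hn : 1 ≤ n) (hP : ∀ i j, P.part i j < n)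
    (hc : ∀ i j, c ≤ j → P.part i j = 0) :
    patNorm (n - 1) n (P.toPattern n c) = sppNorm P := by
  have hrow : ∀ i ∈ Icc 1 n, ∑ j ∈ Icc i n, P.toPattern n c i j =
      ∑ k ∈ range n, ∑ l ∈ range c, if i ≤ P.part k l then 1 else 0 := by
    intro i hi
    rw [mem_Icc] at hi
    rw [sum_subset (Icc_subset_Icc_left hi.1 : Icc i n ⊆ Icc 1 n)]
    · refine sum_nbij' (fun j => n - j) (fun k => n - k) ?_ ?_ ?_ ?_ ?_
      · intro j hj
        simp only [mem_Icc, mem_range] at hj ⊢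
        omega
      · intro k hk
        simp only [mem_Icc, mem_range] at hk ⊢
        omega
      · intro j hj
        simp only [mem_Icc] at hj
        omega
      · intro k hk
        simp only [mem_range] at hk
        omega
      · intro j hj
        rw [toPattern_of_le hi.1 hi.2 (mem_Icc.1 hj).2, card_filter]
        push_cast
        rfl
    · intro j hj hji
      rw [mem_Icc] at hj hji
      exact toPattern_eq_zero hP hi.1 hi.2 (by omega)
  have hpart : ∀ k l, (∑ i ∈ Icc 1 n, if i ≤ P.part k l then (1 : ℤ) else 0) = P.part k l := by
    intro k l
    have hfilter : {i ∈ Icc 1 n | i ≤ P.part k l} = Icc 1 (P.part k l) := by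
      ext i
      have := hP k l
      simp only [mem_filter, mem_Icc]
      omega
    rw [← sum_filter, hfilter]
    simp
  rw [patNorm, Nat.sub_add_cancel hn, sum_congr rfl hrow, sppNorm_eq_sum hP hc, sum_comm]
  push_cast
  refine sum_congr rfl fun k _ => ?_
  rw [sum_comm]
  exact sum_congr rfl fun l _ => hpart k l

end SPP

namespace IsPattern

variable {n c : ℕ} {a : ℕ → ℕ → ℤ}

theorem diag_eq_zero_and_monotone (hn : 1 ≤ n) (ha : IsPattern (n - 1) n c a)
    (h0 : a n n = 0) {i : ℕ} (hi : 1 ≤ i) (hin : i ≤ n) :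
    a i i = 0 ∧ ∀ j, i ≤ j + 1 → j ≤ n → a i j ≤ a i (j + 1) := by
  induction hin using Nat.decreasingInduction with
  | self =>
    refine ⟨h0, fun j hj hjn => ?_⟩
    obtain ⟨h1, h2⟩ := ha.1 n hn (by omega)
    rcases hjn.eq_or_lt with rfl | hlt
    · rw [h0, h2]
      positivity
    · obtain rfl : n = j + 1 := by omega
      rw [h0]
      exact h1.le
  | of_succ i hin ih =>
    obtain ⟨hd, hm⟩ := ih (by omega)
    have hint : ∀ j, i ≤ j → j ≤ n → a (i + 1) j ≤ a i j ∧ a i j ≤ a (i + 1) (j + 1) :=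
      fun j hj hjn => (ha.2.1 (i + 1) j (by omega) (by omega) (by omega) hjn).1
        (hm j (by omega) hjn)
    have hrow := ha.1 i hi (by omega)
    have hrow' := ha.1 (i + 1) (by omega) (by omega)
    rw [Nat.add_sub_cancel] at hrow'
    have hdiag := hint i le_rfl hin.le
    refine ⟨by omega, fun j hj hjn => ?_⟩
    rcases Nat.lt_or_ge j i with hji | hji
    · obtain rfl : i = j + 1 := by omega
      rw [Nat.add_sub_cancel] at hrow
      omega
    · rcases hjn.eq_or_lt with rfl | hlt
      · have := hint j hji le_rfl
        omega
      · exact (hint j hji hjn).2.trans (hint (j + 1) (by omega) hlt).1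

theorem eq_zero_of_le (hn : 1 ≤ n) (ha : IsPattern (n - 1) n c a) (h0 : a n n = 0) {i j : ℕ}
    (hi : 1 ≤ i) (hin : i ≤ n) (hji : j ≤ i) : a i j = 0 := by
  rcases hji.eq_or_lt with rfl | hlt
  · exact (ha.diag_eq_zero_and_monotone hn h0 hi hin).1
  · by_cases hj : j + 1 < i
    · exact ha.2.2 i j (by omega)
    · obtain rfl : j = i - 1 := by omega
      exact (ha.1 i hi (by omega)).1

theorem nonneg (hn : 1 ≤ n) (ha : IsPattern (n - 1) n c a) (h0 : a n n = 0) {i j : ℕ}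
    (hi : 1 ≤ i) (hin : i ≤ n) (hj : j ≤ n + 1) : 0 ≤ a i j := by
  induction j with
  | zero => exact (ha.eq_zero_of_le hn h0 hi hin (by omega)).ge
  | succ j ih =>
    rcases Nat.lt_or_ge i (j + 1) with hij | hij
    · exact (ih (by omega)).trans
        ((ha.diag_eq_zero_and_monotone hn h0 hi hin).2 j (by omega) (by omega))
    · exact (ha.eq_zero_of_le hn h0 hi hin hij).ge

theorem le_last (hn : 1 ≤ n) (ha : IsPattern (n - 1) n c a) (h0 : a n n = 0) {i j : ℕ}
    (hi : 1 ≤ i) (hin : i ≤ n) (hj : j ≤ n + 1) : a i j ≤ c := by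
  induction hj using Nat.decreasingInduction with
  | self => exact (ha.1 i hi (by omega)).2.le
  | of_succ j hj ih =>
    rcases Nat.lt_or_ge i (j + 1) with hij | hij
    · exact ((ha.diag_eq_zero_and_monotone hn h0 hi hin).2 j (by omega) (by omega)).trans ih
    · rw [ha.eq_zero_of_le hn h0 hi hin (by omega)]
      positivity

theorem interlace (hn : 1 ≤ n) (ha : IsPattern (n - 1) n c a) (h0 : a n n = 0) {i j : ℕ}
    (hi : 1 ≤ i) (hin : i < n) (hj : j ≤ n) :
    a (i + 1) j ≤ a i j ∧ a i j ≤ a (i + 1) (j + 1) := by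
  rcases Nat.lt_or_ge j i with hji | hji
  · rw [ha.eq_zero_of_le hn h0 (by omega) hin (by omega : j ≤ i + 1),
      ha.eq_zero_of_le hn h0 hi hin.le hji.le]
    exact ⟨le_rfl, ha.nonneg hn h0 (by omega) hin (by omega)⟩
  · exact (ha.2.1 (i + 1) j (by omega) (by omega) (by omega) hj).1
      ((ha.diag_eq_zero_and_monotone hn h0 (by omega) hin).2 j (by omega) hj)

theorem antitone_col (hn : 1 ≤ n) (ha : IsPattern (n - 1) n c a) (h0 : a n n = 0) {i i' j : ℕ}
    (hi : 1 ≤ i) (hii' : i ≤ i') (hin : i' ≤ n) (hj : j ≤ n) : a i' j ≤ a i j := by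
  induction i', hii' using Nat.le_induction with
  | base => exact le_rfl
  | succ m hm ih => exact (ha.interlace hn h0 (by omega) hin hj).1.trans (ih (by omega))

theorem le_card_filter_iff (hn : 1 ≤ n) (ha : IsPattern (n - 1) n c a) (h0 : a n n = 0)
    {i k l : ℕ} (hi : 1 ≤ i) :
    i ≤ #{m ∈ range n | (l : ℤ) < a (m + 1) (n - k)} ↔ i ≤ n ∧ (l : ℤ) < a i (n - k) := by
  have hfilter : {m ∈ range n | (l : ℤ) < a (m + 1) (n - k)} =
      {m ∈ range n | m < n ∧ (l : ℤ) < a (m + 1) (n - k)} :=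
    filter_congr fun m hm => by simp [mem_range.1 hm]
  obtain ⟨i, rfl⟩ : ∃ m, i = m + 1 := ⟨i - 1, by omega⟩
  rw [hfilter, Nat.succ_le_iff, lt_card_filter_range_iff, Nat.succ_le_iff]
  · exact fun m m' hm h => ⟨hm.trans_lt h.1,
      h.2.trans_le (ha.antitone_col hn h0 (by omega) (by omega) h.1 (by omega))⟩
  · exact fun m h => h.1

theorem exists_toPattern_eq (hn : 1 ≤ n) (ha : IsPattern (n - 1) n c a) (h0 : a n n = 0) :
    ∃ P : SPP, (∀ i j, P.part i j < n) ∧ (∀ i j, c ≤ j → P.part i j = 0) ∧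
      P.toPattern n c = a := by
  obtain ⟨f, hf⟩ : ∃ f : ℕ → ℕ → ℕ, ∀ i k l, 1 ≤ i →
      (i ≤ f k l ↔ i ≤ n ∧ (l : ℤ) < a i (n - k)) :=
    ⟨_, fun i k l => ha.le_card_filter_iff hn h0⟩
  have hself : ∀ k l, f k l ≠ 0 → f k l ≤ n ∧ (l : ℤ) < a (f k l) (n - k) := fun k l h =>
    (hf (f k l) k l (Nat.one_le_iff_ne_zero.2 h)).1 le_rfl
  have hlt : ∀ k l, f k l < n := by
    intro k l
    by_contra h
    have h1 := ((hf n k l hn).1 (by omega)).2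
    rw [ha.eq_zero_of_le hn h0 hn le_rfl (by omega)] at h1
    omega
  have hcol : ∀ k l, c ≤ l → f k l = 0 := by
    intro k l hl
    by_contra h
    obtain ⟨h1, h2⟩ := hself k l h
    have := ha.le_last hn h0 (Nat.one_le_iff_ne_zero.2 h) h1 (by omega : n - k ≤ n + 1)
    omega
  have hrow : ∀ k l, n ≤ k → f k l = 0 := by
    intro k l hk
    by_contra h
    obtain ⟨h1, h2⟩ := hself k l h
    rw [ha.eq_zero_of_le hn h0 (Nat.one_le_iff_ne_zero.2 h) h1 (by omega)] at h2
    omega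
  refine ⟨⟨f, ?_, ?_, ?_⟩, hlt, hcol, ?_⟩
  · refine (range n ×ˢ range c).finite_toSet.subset ?_
    rintro ⟨k, l⟩ h
    simp only [Set.mem_ofPred_eq] at h
    simp only [coe_product, Set.mem_prod, mem_coe, mem_range]
    constructor
    · by_contra hk
      exact h (hrow k l (by omega))
    · by_contra hl
      exact h (hcol k l (by omega))
  · intro k l l' hl
    by_cases h : f k l' = 0
    · omega
    · obtain ⟨h1, h2⟩ := hself k l' h
      exact (hf _ k l (Nat.one_le_iff_ne_zero.2 h)).2 ⟨h1, by omega⟩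
  · intro k l h
    obtain ⟨-, h2⟩ := hself (k + 1) l h
    have hk : k + 1 < n := by
      by_contra hk
      exact h (hrow _ l (by omega))
    have h3 := (ha.interlace hn h0 (Nat.one_le_iff_ne_zero.2 h) (hlt (k + 1) l)
      (by omega : n - (k + 1) ≤ n)).2
    rw [show n - (k + 1) + 1 = n - k by omega] at h3
    exact (hf _ k l (by omega)).2 ⟨hlt (k + 1) l, h2.trans_le h3⟩
  · funext i j
    by_cases hi : 1 ≤ i ∧ i ≤ n
    · by_cases hj : j ≤ n
      · rw [SPP.toPattern_of_le hi.1 hi.2 hj]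
        have hnn := ha.nonneg hn h0 hi.1 hi.2 (by omega : j ≤ n + 1)
        have hle := ha.le_last hn h0 hi.1 hi.2 (by omega : j ≤ n + 1)
        have hfilter : {l ∈ range c | i ≤ f (n - j) l} = range (a i j).toNat := by
          ext l
          simp only [mem_filter, mem_range, hf _ _ _ hi.1, Nat.sub_sub_self hj]
          omega
        rw [hfilter, card_range, Int.toNat_of_nonneg hnn]
      · by_cases hj' : j = n + 1
        · rw [hj', SPP.toPattern_last hi.1 hi.2, (ha.1 i hi.1 (by omega)).2]
        · rw [ha.2.2 i j (by omega)]
          simp [SPP.toPattern, hj, hj']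
    · rw [ha.2.2 i j (by omega)]
      exact if_neg hi

end IsPattern

theorem SPP.bijOn_toPattern {n c p : ℕ} (hn : 1 ≤ n) :
    Set.BijOn (SPP.toPattern n c)
      {P : SPP | (∀ i j, P.part i j ≤ n - 1) ∧ (∀ i j, c ≤ j → P.part i j = 0) ∧ oddRows P = p}
      {a : ℕ → ℕ → ℤ | IsPattern (n - 1) n c a ∧ a n n = 0 ∧ oddTop n a = p} := by
  have hlt : ∀ {P : SPP}, (∀ i j, P.part i j ≤ n - 1) → ∀ i j, P.part i j < n :=
    fun h i j => by have := h i j; omega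
  refine ⟨?_, fun P hP Q hQ => SPP.toPattern_injOn ⟨hlt hP.1, hP.2.1⟩ ⟨hlt hQ.1, hQ.2.1⟩, ?_⟩
  · rintro P ⟨hP, hc, hodd⟩
    exact ⟨P.isPattern_toPattern hn (hlt hP), P.toPattern_eq_zero (hlt hP) hn le_rfl le_rfl,
      (P.oddTop_toPattern hn (hlt hP) hc).trans hodd⟩
  · rintro a ⟨ha, h0, hodd⟩
    obtain ⟨P, hP, hc, rfl⟩ := ha.exists_toPattern_eq hn h0
    exact ⟨P, ⟨fun i j => Nat.le_sub_one_of_lt (hP i j), hc,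
      (P.oddTop_toPattern hn hP hc).symm.trans hodd⟩, rfl⟩

/-- **Lemma (initial conditions), first identity:** `F_q(n-1,n,c,p;0) = G_{n-1,c,p}`. -/
theorem statement11 (n c p : ℕ) (hn : 1 ≤ n) (hp : p ≤ n - 1) :
    Fq n c p 0 = Gspp (n - 1) c p := by
  rw [Fq, Gspp, zpow_zero, div_one]
  symm
  refine finsum_mem_eq_of_bijOn _ (SPP.bijOn_toPattern hn) fun P hmem => ?_
  obtain ⟨hP, hc, -⟩ := hmem
  have hlt : ∀ i j, P.part i j < n := fun i j => by have := hP i j; omega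
  rw [patSign, P.invCount_toPattern hn, P.patNorm_toPattern hn hlt hc, pow_zero, one_mul,
    zpow_natCast]
end
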